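/- arXiv:1306.2020 — 5 statements merged into one kernel-verified Lean document; each statement's English description precedes it below -/
import Mathlib

section
/- Let C_n (n odd) be the circular tournament on vertex set ℤ/nℤ, with an edge i → j iff (j − i) mod n ∈ {1, …, (n−1)/2}. Then t₄(C_n) → 1/2 as n → ∞ (and hence also c₄(C_n) → 1/2): for every ε > 0 there is N such that |t₄(C_n) − 1/2| ≤ ε for all odd n ≥ N. -/
open Finset

/-- A tournament: an irreflexive relation such that for distinct vertices exactly one of
`r x y`, `r y x` holds. -/
def IsTournament {V : Type} (r : V → V → Prop) : Prop :=
  (∀ x, ¬ r x x) ∧ ∀ x y : V, x ≠ y → (r x y ↔ ¬ r y x)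

/-- The transitive tournament on 4 vertices. -/
def T4rel : Fin 4 → Fin 4 → Prop := fun i j => i < j

/-- The unique strongly connected tournament on 4 vertices. -/
def C4rel : Fin 4 → Fin 4 → Prop := fun i j =>
  (i = 0 ∧ j = 1) ∨ (i = 1 ∧ j = 2) ∨ (i = 2 ∧ j = 3) ∨ (i = 3 ∧ j = 0) ∨
  (i = 0 ∧ j = 2) ∨ (i = 1 ∧ j = 3)

/-- The 4-vertex tournament in which a cyclic triangle beats a fourth vertex. -/
def W4rel : Fin 4 → Fin 4 → Prop := fun i j =>
  (i = 0 ∧ j = 1) ∨ (i = 1 ∧ j = 2) ∨ (i = 2 ∧ j = 0) ∨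
  (i = 0 ∧ j = 3) ∨ (i = 1 ∧ j = 3) ∨ (i = 2 ∧ j = 3)

/-- The 4-vertex tournament in which one vertex beats a cyclic triangle. -/
def L4rel : Fin 4 → Fin 4 → Prop := fun i j =>
  (i = 0 ∧ j = 1) ∨ (i = 1 ∧ j = 2) ∨ (i = 2 ∧ j = 0) ∨
  (i = 3 ∧ j = 0) ∨ (i = 3 ∧ j = 1) ∨ (i = 3 ∧ j = 2)

/-- The cyclic triangle (directed 3-cycle). -/
def C3rel : Fin 3 → Fin 3 → Prop := fun i j =>
  (i = 0 ∧ j = 1) ∨ (i = 1 ∧ j = 2) ∨ (i = 2 ∧ j = 0)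

/-- `s` induces a subtournament isomorphic to the pattern `m`. -/
def InducesPattern {V : Type} {k : ℕ} (r : V → V → Prop) (m : Fin k → Fin k → Prop)
    (s : Finset V) : Prop :=
  ∃ f : Fin k → V, Function.Injective f ∧ Set.range f = (s : Set V) ∧
    ∀ i j : Fin k, m i j ↔ r (f i) (f j)

-- the number of `k`-element vertex subsets inducing a copy of the pattern `m`
open Classical in
noncomputable def patternCount {V : Type} [Fintype V] {k : ℕ} (r : V → V → Prop)
    (m : Fin k → Fin k → Prop) : ℕ :=
  (((univ : Finset V).powersetCard k).filter (fun s => InducesPattern r m s)).card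

-- the probability that a uniformly random `k`-element vertex subset induces a copy of `m`
noncomputable def patternDensity {V : Type} [Fintype V] {k : ℕ} (r : V → V → Prop)
    (m : Fin k → Fin k → Prop) : ℝ :=
  (patternCount r m : ℝ) / ((Fintype.card V).choose k)

/-- The circular tournament on `n` vertices (for odd `n`): `i → j` iff the clockwise
distance from `i` to `j` is between `1` and `(n-1)/2`. -/
def circRel (n : ℕ) : Fin n → Fin n → Prop := fun i j =>
  1 ≤ (j.val + n - i.val) % n ∧ (j.val + n - i.val) % n ≤ (n - 1) / 2

lemma circRel_iff (m : ℕ) (i j : Fin (2 * m + 1)) :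
    circRel (2 * m + 1) i j ↔
      (i.val < j.val ∧ j.val ≤ i.val + m) ∨ (j.val + m < i.val) := by
  unfold circRel
  have hi := i.isLt
  have hj := j.isLt
  rcases lt_trichotomy i.val j.val with h | h | h
  · have : (j.val + (2 * m + 1) - i.val) % (2 * m + 1) = j.val - i.val := by
      rw [show j.val + (2 * m + 1) - i.val = (j.val - i.val) + (2 * m + 1) by omega,
        Nat.add_mod_right, Nat.mod_eq_of_lt (by omega)]
    rw [this]; omega
  · have : (j.val + (2 * m + 1) - i.val) % (2 * m + 1) = 0 := by
      rw [show j.val + (2 * m + 1) - i.val = 2 * m + 1 by omega, Nat.mod_self]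
    rw [this]; omega
  · rw [Nat.mod_eq_of_lt (by omega)]; omega

lemma circRel_asymm (m : ℕ) (i j : Fin (2 * m + 1)) (h : circRel (2 * m + 1) i j) :
    ¬ circRel (2 * m + 1) j i := by
  rw [circRel_iff] at *; omega

lemma circRel_card (m : ℕ) (v : Fin (2 * m + 1)) [DecidablePred (circRel (2 * m + 1) v)] :
    (univ.filter (circRel (2 * m + 1) v)).card = m := by
  have hv := v.isLt
  have : (univ.filter (circRel (2 * m + 1) v)).card = (Icc 1 m).card := by
    symm
    refine Finset.card_bij (fun k _ => (⟨if v.val + k < 2 * m + 1 then v.val + k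
      else (v.val + k) - (2 * m + 1), ?_⟩ : Fin (2 * m + 1))) ?_ ?_ ?_
    · rename_i hk
      rw [mem_Icc] at hk
      split_ifs <;> omega
    · intro k hk
      rw [mem_Icc] at hk
      simp only [mem_filter, mem_univ, true_and, circRel_iff]
      split_ifs <;> omega
    · intro a ha b hb hab
      rw [mem_Icc] at ha hb
      simp only [Fin.mk.injEq] at hab
      split_ifs at hab <;> omega
    · intro w hw
      have hwl := w.isLt
      simp only [mem_filter, mem_univ, true_and, circRel_iff] at hw
      rcases hw with hw | hw
      · refine ⟨w.val - v.val, by rw [mem_Icc]; omega, ?_⟩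
        ext
        simp only
        split_ifs <;> omega
      · refine ⟨w.val + (2 * m + 1) - v.val, by rw [mem_Icc]; omega, ?_⟩
        ext
        simp only
        split_ifs <;> omega
  simpa using this

lemma induces_of_rot {n : ℕ} (r : Fin n → Fin n → Prop) (p : Fin 4 → Fin 4 → Prop)
    (s : Finset (Fin n)) (g : Fin 4 → Fin n) (hg : Function.Injective g)
    (hs : Set.range g = (s : Set (Fin n))) (k : Fin 4)
    (h : ∀ i j, p i j ↔ r (g (i + k)) (g (j + k))) : InducesPattern r p s := by
  refine ⟨fun i => g (i + k), fun a b hab => add_right_cancel (hg hab), ?_, h⟩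
  rw [← hs]
  exact (Equiv.addRight k).surjective.range_comp g

lemma dichotomy (m : ℕ) (s : Finset (Fin (2 * m + 1))) (hs : s.card = 4) :
    InducesPattern (circRel (2 * m + 1)) T4rel s ∨
      InducesPattern (circRel (2 * m + 1)) C4rel s := by
  let g := s.orderEmbOfFin hs
  have hg : Function.Injective g := g.injective
  have hr : Set.range g = (s : Set _) := s.range_orderEmbOfFin hs
  have h01 : (g 0).val < (g 1).val := g.strictMono (by decide)
  have h12 : (g 1).val < (g 2).val := g.strictMono (by decide)
  have h23 : (g 2).val < (g 3).val := g.strictMono (by decide)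
  have h3 := (g 3).isLt
  have key : ∀ (p : Fin 4 → Fin 4 → Prop) (k : Fin 4),
      (∀ i j, p i j ↔ circRel (2 * m + 1) (g (i + k)) (g (j + k))) →
      InducesPattern (circRel (2 * m + 1)) p s :=
    fun p k h => induces_of_rot _ p s g hg hr k h
  clear_value g
  have e1 : (1 : Fin 4) + 3 = 0 := rfl
  have e2 : (2 : Fin 4) + 3 = 1 := rfl
  have e3 : (3 : Fin 4) + 3 = 2 := rfl
  have e4 : (1 : Fin 4) + 2 = 3 := rfl
  have e5 : (2 : Fin 4) + 2 = 0 := rfl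
  have e6 : (3 : Fin 4) + 2 = 1 := rfl
  have e7 : (1 : Fin 4) + 1 = 2 := rfl
  have e8 : (2 : Fin 4) + 1 = 3 := rfl
  have e9 : (3 : Fin 4) + 1 = 0 := rfl
  have key2 : ∀ (p : Fin 4 → Fin 4 → Prop) (k : Fin 4),
      ((p 0 0 ↔ circRel (2 * m + 1) (g (0 + k)) (g (0 + k))) ∧
       (p 0 1 ↔ circRel (2 * m + 1) (g (0 + k)) (g (1 + k))) ∧
       (p 0 2 ↔ circRel (2 * m + 1) (g (0 + k)) (g (2 + k))) ∧
       (p 0 3 ↔ circRel (2 * m + 1) (g (0 + k)) (g (3 + k)))) ∧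
      ((p 1 0 ↔ circRel (2 * m + 1) (g (1 + k)) (g (0 + k))) ∧
       (p 1 1 ↔ circRel (2 * m + 1) (g (1 + k)) (g (1 + k))) ∧
       (p 1 2 ↔ circRel (2 * m + 1) (g (1 + k)) (g (2 + k))) ∧
       (p 1 3 ↔ circRel (2 * m + 1) (g (1 + k)) (g (3 + k)))) ∧
      ((p 2 0 ↔ circRel (2 * m + 1) (g (2 + k)) (g (0 + k))) ∧
       (p 2 1 ↔ circRel (2 * m + 1) (g (2 + k)) (g (1 + k))) ∧
       (p 2 2 ↔ circRel (2 * m + 1) (g (2 + k)) (g (2 + k))) ∧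
       (p 2 3 ↔ circRel (2 * m + 1) (g (2 + k)) (g (3 + k)))) ∧
      ((p 3 0 ↔ circRel (2 * m + 1) (g (3 + k)) (g (0 + k))) ∧
       (p 3 1 ↔ circRel (2 * m + 1) (g (3 + k)) (g (1 + k))) ∧
       (p 3 2 ↔ circRel (2 * m + 1) (g (3 + k)) (g (2 + k))) ∧
       (p 3 3 ↔ circRel (2 * m + 1) (g (3 + k)) (g (3 + k)))) →
      InducesPattern (circRel (2 * m + 1)) p s := by
    intro p k h
    apply key p k
    simp only [Fin.forall_fin_succ, IsEmpty.forall_iff, and_true]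
    exact h
  simp only [circRel_iff] at key2
  by_cases hd : (g 3).val ≤ (g 0).val + m
  · left
    apply key2 T4rel 0
    simp [T4rel]
    omega
  by_cases hx : (g 0).val + m < (g 1).val
  · left
    apply key2 T4rel 1
    simp [T4rel, e7, e8, e9]
    omega
  by_cases hy : (g 1).val + m < (g 2).val
  · left
    apply key2 T4rel 2
    simp [T4rel, e4, e5, e6]
    omega
  by_cases hz : (g 2).val + m < (g 3).val
  · left
    apply key2 T4rel 3
    simp [T4rel, e1, e2, e3]
    omega
  right
  by_cases hac : (g 2).val ≤ (g 0).val + m <;> by_cases hbd : (g 3).val ≤ (g 1).val + m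
  · apply key2 C4rel 0
    simp [C4rel]
    omega
  · apply key2 C4rel 3
    simp [C4rel, e1, e2, e3]
    omega
  · apply key2 C4rel 1
    simp [C4rel, e7, e8, e9]
    omega
  · apply key2 C4rel 2
    simp [C4rel, e4, e5, e6]
    omega

/-- `v` is a source of `s`. -/
def IsSource {V : Type} (r : V → V → Prop) (s : Finset V) (v : V) : Prop :=
  v ∈ s ∧ ∀ w ∈ s, w ≠ v → r v w

lemma source_of_T4 {V : Type} (r : V → V → Prop) (s : Finset V)
    (h : InducesPattern r T4rel s) : ∃ v, IsSource r s v := by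
  obtain ⟨f, hf, hs, hr⟩ := h
  refine ⟨f 0, ?_, ?_⟩
  · rw [← mem_coe, ← hs]; exact ⟨0, rfl⟩
  · intro w hw hne
    rw [← mem_coe, ← hs] at hw
    obtain ⟨i, rfl⟩ := hw
    refine (hr 0 i).1 ?_
    have : i ≠ 0 := fun h => hne (by rw [h])
    exact Fin.pos_of_ne_zero this

lemma not_source_of_C4 (m : ℕ) (s : Finset (Fin (2 * m + 1)))
    (h : InducesPattern (circRel (2 * m + 1)) C4rel s) (v : Fin (2 * m + 1)) :
    ¬ IsSource (circRel (2 * m + 1)) s v := by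
  obtain ⟨f, hf, hs, hr⟩ := h
  rintro ⟨hv, hsrc⟩
  rw [← mem_coe, ← hs] at hv
  obtain ⟨i, rfl⟩ := hv
  have hc : C4rel (i + 3) i := by
    fin_cases i <;> simp [C4rel]
  have h1 := (hr _ _).1 hc
  refine circRel_asymm m _ _ h1 (hsrc _ ?_ ?_)
  · rw [← mem_coe, ← hs]; exact ⟨_, rfl⟩
  · intro he
    rw [he] at h1
    exact circRel_asymm m _ _ h1 h1

lemma count_T4 (m : ℕ) :
    patternCount (circRel (2 * m + 1)) T4rel = (2 * m + 1) * m.choose 3 := by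
  classical
  unfold patternCount
  set r := circRel (2 * m + 1) with hr
  have hirr : ∀ v, ¬ r v v := fun v h => circRel_asymm m _ _ h h
  have hcard : ((univ : Finset (Fin (2 * m + 1))).sigma
      (fun v => powersetCard 3 (univ.filter (r v)))).card = (2 * m + 1) * m.choose 3 := by
    rw [card_sigma, sum_congr rfl (fun v _ => by rw [card_powersetCard, hr, circRel_card])]
    simp
  rw [← hcard]
  symm
  have hsrc : ∀ (v : Fin (2 * m + 1)) (t : Finset (Fin (2 * m + 1))),
      t ⊆ univ.filter (r v) → v ∉ t := by
    intro v t ht hv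
    exact hirr v (mem_filter.1 (ht hv)).2
  refine Finset.card_bij (fun x _ => insert x.1 x.2) ?_ ?_ ?_
  · rintro ⟨v, t⟩ hx
    simp only [mem_sigma, mem_univ, true_and, mem_powersetCard] at hx
    have hc : (insert v t).card = 4 := by
      rw [card_insert_of_notMem (hsrc v t hx.1), hx.2]
    rw [mem_filter, mem_powersetCard]
    refine ⟨⟨subset_univ _, hc⟩, ?_⟩
    rcases dichotomy m _ hc with h | h
    · convert h
    · refine absurd ?_ (not_source_of_C4 m _ h v)
      refine ⟨mem_insert_self _ _, ?_⟩
      intro w hw hne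
      rcases mem_insert.1 hw with rfl | hw
      · exact absurd rfl hne
      · exact (mem_filter.1 (hx.1 hw)).2
  · rintro ⟨v, t⟩ hx ⟨v', t'⟩ hx' he
    simp only [mem_sigma, mem_univ, true_and, mem_powersetCard] at hx hx'
    simp only at he
    have hvv : v = v' := by
      by_contra hne
      have h1 : v ∈ t' := by
        have : v ∈ insert v' t' := he ▸ mem_insert_self v t
        exact (mem_insert.1 this).resolve_left hne
      have h2 : v' ∈ t := by
        have : v' ∈ insert v t := he ▸ mem_insert_self v' t'
        exact (mem_insert.1 this).resolve_left (Ne.symm hne)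
      exact circRel_asymm m _ _ (mem_filter.1 (hx.1 h2)).2 (mem_filter.1 (hx'.1 h1)).2
    subst hvv
    have : t = t' := by
      rw [← erase_insert (hsrc v t hx.1), he, erase_insert (hsrc v t' hx'.1)]
    rw [this]
  · intro s hs
    rw [mem_filter, mem_powersetCard] at hs
    obtain ⟨v, hv, hw⟩ := source_of_T4 _ _ hs.2
    refine ⟨⟨v, s.erase v⟩, ?_, insert_erase hv⟩
    simp only [mem_sigma, mem_univ, true_and, mem_powersetCard]
    refine ⟨?_, by rw [card_erase_of_mem hv, hs.1.2]⟩
    intro w hws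
    rw [mem_erase] at hws
    exact mem_filter.2 ⟨mem_univ _, hw w hws.2 hws.1⟩

lemma count_add (m : ℕ) :
    patternCount (circRel (2 * m + 1)) T4rel + patternCount (circRel (2 * m + 1)) C4rel
      = (2 * m + 1).choose 4 := by
  classical
  have h : ((univ : Finset (Fin (2 * m + 1))).powersetCard 4).card = (2 * m + 1).choose 4 := by
    simp
  unfold patternCount
  rw [← h, ← card_filter_add_card_filter_not
    (s := (univ : Finset (Fin (2 * m + 1))).powersetCard 4)
    (fun s => InducesPattern (circRel (2 * m + 1)) T4rel s)]
  congr 1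
  · congr 1
    ext s
    simp only [mem_filter, mem_powersetCard]
    refine and_congr_right fun hs => ⟨fun hC hT => ?_, fun hT => ?_⟩
    · obtain ⟨v, hv⟩ := source_of_T4 _ _ hT
      exact not_source_of_C4 m s hC v hv
    · exact (dichotomy m s hs.2).resolve_left hT

lemma density_T4 (k : ℕ) :
    patternDensity (circRel (2 * (k + 3) + 1)) T4rel = ((k : ℝ) + 1) / (2 * k + 5) := by
  unfold patternDensity
  rw [count_T4, Fintype.card_fin]
  have h3 : (((k + 3).choose 3 : ℕ) : ℝ) * 6 = (k + 3) * (k + 2) * (k + 1) := by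
    have := Nat.descFactorial_eq_factorial_mul_choose (k + 3) 3
    simp [Nat.descFactorial_succ, Nat.factorial] at this
    have h2 : (((k + 1) * ((k + 2) * (k + 3)) : ℕ) : ℝ) = ((6 * (k + 3).choose 3 : ℕ) : ℝ) := by
      exact_mod_cast this
    push_cast at h2
    linarith
  have h4 : (((2 * (k + 3) + 1).choose 4 : ℕ) : ℝ) * 24
      = (2 * k + 7) * (2 * k + 6) * (2 * k + 5) * (2 * k + 4) := by
    have := Nat.descFactorial_eq_factorial_mul_choose (2 * k + 3 + 4) 4
    simp [Nat.descFactorial_succ, Nat.factorial] at this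
    rw [show 2 * (k + 3) + 1 = 2 * k + 3 + 4 by ring]
    have h2 : (((2 * k + 3 + 1) * ((2 * k + 3 + 2) * ((2 * k + 3 + 3) * (2 * k + 3 + 4))) : ℕ) : ℝ)
      = ((24 * (2 * k + 3 + 4).choose 4 : ℕ) : ℝ) := by
      exact_mod_cast this
    push_cast at h2
    linarith
  have h3' : (((k + 3).choose 3 : ℕ) : ℝ) = (k + 3) * (k + 2) * (k + 1) / 6 := by linarith
  have h4' : (((2 * (k + 3) + 1).choose 4 : ℕ) : ℝ)
      = (2 * k + 7) * (2 * k + 6) * (2 * k + 5) * (2 * k + 4) / 24 := by linarith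
  push_cast
  rw [h3', h4']
  field_simp
  ring

lemma density_add (k : ℕ) :
    patternDensity (circRel (2 * (k + 3) + 1)) C4rel =
      1 - patternDensity (circRel (2 * (k + 3) + 1)) T4rel := by
  have h := count_add (k + 3)
  have hp : 0 < (2 * (k + 3) + 1).choose 4 := Nat.choose_pos (by omega)
  unfold patternDensity
  rw [Fintype.card_fin, ← h]
  rw [← h] at hp
  have hp' : (((patternCount (circRel (2 * (k + 3) + 1)) T4rel
    + patternCount (circRel (2 * (k + 3) + 1)) C4rel : ℕ)) : ℝ) ≠ 0 := by
    exact_mod_cast hp.ne'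
  rw [eq_sub_iff_add_eq, ← add_div, div_eq_one_iff_eq hp']
  push_cast
  ring

/-- For circular tournaments, `t₄ → 1/2` (and hence also `c₄ → 1/2`) as the odd number of
vertices tends to infinity. -/
theorem circular_tournament_t4_tendsto_half :
    ∀ ε : ℝ, 0 < ε → ∃ N : ℕ, ∀ n : ℕ, Odd n → N ≤ n →
      |patternDensity (circRel n) T4rel - 1 / 2| ≤ ε ∧
      |patternDensity (circRel n) C4rel - 1 / 2| ≤ ε := by
  intro ε hε
  obtain ⟨K, hK⟩ := exists_nat_gt (2 / ε)
  refine ⟨K + 7, ?_⟩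
  rintro n ⟨m, rfl⟩ hn
  obtain ⟨k, rfl⟩ : ∃ k, m = k + 3 := ⟨m - 3, by omega⟩
  have hk : (K : ℝ) ≤ 2 * k := by
    have : K ≤ 2 * k := by omega
    exact_mod_cast this
  have hpos : (0 : ℝ) < 2 * k + 5 := by positivity
  have hb : 3 / (2 * (2 * (k : ℝ) + 5)) ≤ ε := by
    rw [div_le_iff₀ (by positivity)]
    rw [div_lt_iff₀ hε] at hK
    nlinarith
  have hb0 : 0 ≤ 3 / (2 * (2 * (k : ℝ) + 5)) := by positivity
  have hT : patternDensity (circRel (2 * (k + 3) + 1)) T4rel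
      = 1 / 2 - 3 / (2 * (2 * (k : ℝ) + 5)) := by
    rw [density_T4]
    field_simp
    ring
  rw [density_add, hT]
  constructor <;> rw [abs_le] <;> constructor <;> linarith
end

section
/- Every tournament on n vertices contains at most (n³ − n)/24 cyclic triangles. Equivalently, for every ε > 0 there is N such that the proportion t₃ of 3-element vertex subsets inducing a transitive subtournament satisfies t₃ ≥ 3/4 − ε in every tournament on n ≥ N vertices. -/
open Finset

/-- The relation `r` restricted to `s` is transitive; for a tournament this says exactly
that `s` induces a transitive subtournament. -/
def TransOn {V : Type} (r : V → V → Prop) (s : Finset V) : Prop :=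
  ∀ x ∈ s, ∀ y ∈ s, ∀ z ∈ s, r x y → r y z → r x z

-- the probability that a uniformly random `k`-element vertex subset induces a transitive
-- subtournament
open Classical in
noncomputable def transDensity {V : Type} [Fintype V] (k : ℕ) (r : V → V → Prop) : ℝ :=
  ((((univ : Finset V).powersetCard k).filter (fun s => TransOn r s)).card : ℝ) /
    ((Fintype.card V).choose k)

open Classical in
/-- Indicator of an arc. -/
noncomputable def arcInd {V : Type} (r : V → V → Prop) (x y : V) : ℝ := if r x y then 1 else 0

/-- Sign of an arc. -/
noncomputable def arcSgn {V : Type} (r : V → V → Prop) (x y : V) : ℝ := arcInd r x y - arcInd r y x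

open Classical in
theorem pointwise_id {V : Type} (r : V → V → Prop) (h : IsTournament r) (x y z : V) :
    arcInd r x y * arcInd r y z * arcInd r z x + arcInd r x z * arcInd r z y * arcInd r y x =
    (arcSgn r x y * arcSgn r y z + arcSgn r y z * arcSgn r z x + arcSgn r z x * arcSgn r x y + 1
      - (if x = y then (if x = z then 1 else 0) else 0)) / 4 := by
  obtain ⟨h0, h1⟩ := h
  have key : ∀ u v : V, u ≠ v → (arcInd r u v = 1 ∧ arcInd r v u = 0) ∨
      (arcInd r u v = 0 ∧ arcInd r v u = 1) := by
    intro u v huv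
    have := h1 u v huv
    unfold arcInd
    by_cases hh : r u v
    · left; simp [hh, this.mp hh]
    · right
      have : r v u := by tauto
      simp [hh, this]
  have d : ∀ u : V, arcInd r u u = 0 := fun u => by simp [arcInd, h0]
  unfold arcSgn
  by_cases hxy : x = y
  · subst hxy
    by_cases hxz : x = z
    · subst hxz; simp [d]
    · rcases key x z hxz with ⟨a, b⟩ | ⟨a, b⟩ <;> simp [d, a, b, hxz]
  · by_cases hxz : x = z
    · subst hxz
      rcases key x y hxy with ⟨a, b⟩ | ⟨a, b⟩ <;> simp [d, a, b, hxy]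
    · by_cases hyz : y = z
      · subst hyz
        rcases key x y hxy with ⟨a, b⟩ | ⟨a, b⟩ <;> simp [d, a, b, hxy]
      · rcases key x y hxy with ⟨a, b⟩ | ⟨a, b⟩ <;> rcases key x z hxz with ⟨c, e⟩ | ⟨c, e⟩ <;>
          rcases key y z hyz with ⟨f, g⟩ | ⟨f, g⟩ <;> simp [a, b, c, e, f, g, hxy] <;> norm_num

theorem sum_path_nonpos {V : Type} [Fintype V] (r : V → V → Prop) :
    ∑ x : V, ∑ y : V, ∑ z : V, arcSgn r x y * arcSgn r y z ≤ 0 := by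
  rw [Finset.sum_comm]
  apply Finset.sum_nonpos
  intro y _
  rw [← Finset.sum_mul_sum]
  have : ∑ x : V, arcSgn r x y = - ∑ x : V, arcSgn r y x := by
    rw [← Finset.sum_neg_distrib]
    exact Finset.sum_congr rfl fun x _ => by unfold arcSgn; ring
  rw [this]
  nlinarith [mul_self_nonneg (∑ x : V, arcSgn r y x)]

theorem rot_sum {V : Type} [Fintype V] (F : V → V → V → ℝ) :
    ∑ x : V, ∑ y : V, ∑ z : V, F y z x = ∑ x : V, ∑ y : V, ∑ z : V, F x y z := by
  rw [Finset.sum_comm]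
  exact Finset.sum_congr rfl fun y _ => Finset.sum_comm

theorem sum_cyc_le {V : Type} [Fintype V] (r : V → V → Prop) (h : IsTournament r) :
    ∑ x : V, ∑ y : V, ∑ z : V, arcInd r x y * arcInd r y z * arcInd r z x ≤
      ((Fintype.card V : ℝ) ^ 3 - (Fintype.card V : ℝ)) / 8 := by
  classical
  have e := Finset.sum_congr rfl fun (x : V) (_ : x ∈ univ) =>
    Finset.sum_congr rfl fun (y : V) (_ : y ∈ univ) =>
    Finset.sum_congr rfl fun (z : V) (_ : z ∈ univ) => pointwise_id r h x y z
  simp only [Finset.sum_add_distrib, Finset.sum_sub_distrib, ← Finset.sum_div] at e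
  have s1 := sum_path_nonpos r
  have s2 := rot_sum fun x y z => arcSgn r x y * arcSgn r y z
  have s3 := rot_sum fun x y z => arcSgn r y z * arcSgn r z x
  have s4 : ∑ x : V, ∑ y : V, ∑ z : V, arcInd r x z * arcInd r z y * arcInd r y x =
      ∑ x : V, ∑ y : V, ∑ z : V, arcInd r x y * arcInd r y z * arcInd r z x :=
    Finset.sum_congr rfl fun x _ => Finset.sum_comm
  have s5 : ∑ x : V, ∑ y : V, ∑ z : V, (if x = y then (if x = z then (1 : ℝ) else 0) else 0) =
      Fintype.card V := by
    have : ∀ x y : V, ∑ z : V, (if x = y then (if x = z then (1 : ℝ) else 0) else 0) =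
      if x = y then 1 else 0 := by
      intro x y
      by_cases hh : x = y <;> simp [hh]
    simp [this]
  have s6 : ∑ x : V, ∑ y : V, ∑ z : V, (1 : ℝ) = (Fintype.card V : ℝ) ^ 3 := by
    simp; ring
  rw [s4, s5, s6] at e
  linarith

theorem three_count_le {V : Type} [Fintype V] (r : V → V → Prop) (h : IsTournament r) :
    3 * (patternCount r C3rel : ℝ) ≤
      ∑ x : V, ∑ y : V, ∑ z : V, arcInd r x y * arcInd r y z * arcInd r z x := by
  classical
  set A : Finset (V × V × V) :=
    univ.filter fun p => r p.1 p.2.1 ∧ r p.2.1 p.2.2 ∧ r p.2.2 p.1 with hA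
  have e : ∑ x : V, ∑ y : V, ∑ z : V, arcInd r x y * arcInd r y z * arcInd r z x =
      (A.card : ℝ) := by
    rw [hA, Finset.card_filter]
    push_cast
    rw [Fintype.sum_prod_type]
    refine Finset.sum_congr rfl fun x _ => ?_
    rw [Fintype.sum_prod_type]
    refine Finset.sum_congr rfl fun y _ => Finset.sum_congr rfl fun z _ => ?_
    unfold arcInd
    by_cases h1 : r x y <;> by_cases h2 : r y z <;> by_cases h3 : r z x <;> simp [h1, h2, h3]
  rw [e]
  set B := ((univ : Finset V).powersetCard 3).filter (fun s => InducesPattern r C3rel s) with hB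
  have hc : patternCount r C3rel = B.card := by
    rw [hB]; unfold patternCount; congr
  rw [hc]
  have key : ∀ s ∈ B, 3 ≤ (A.filter fun p => ({p.1, p.2.1, p.2.2} : Finset V) = s).card := by
    intro s hs
    obtain ⟨f, hf, hr, hm⟩ := (Finset.mem_filter.mp hs).2
    have h01 : r (f 0) (f 1) := (hm 0 1).mp (by simp [C3rel])
    have h12 : r (f 1) (f 2) := (hm 1 2).mp (by simp [C3rel])
    have h20 : r (f 2) (f 0) := (hm 2 0).mp (by simp [C3rel])
    have n01 : f 0 ≠ f 1 := fun hh => by have := hf hh; simp at this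
    have n12 : f 1 ≠ f 2 := fun hh => by have := hf hh; simp at this
    have n20 : f 2 ≠ f 0 := fun hh => by have := hf hh; simp at this
    have hs' : ∀ v, v ∈ s ↔ v = f 0 ∨ v = f 1 ∨ v = f 2 := by
      intro v
      rw [← Finset.mem_coe, ← hr, Set.mem_range, Fin.exists_fin_succ, Fin.exists_fin_two]
      simp only [eq_comm (b := v)]
      rfl
    have hcard : ({(f 0, f 1, f 2), (f 1, f 2, f 0), (f 2, f 0, f 1)} :
        Finset (V × V × V)).card = 3 := by
      rw [Finset.card_eq_three]
      refine ⟨_, _, _, ?_, ?_, ?_, rfl⟩ <;> simp [n01, n12, n20, n20.symm]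
    rw [← hcard]
    apply Finset.card_le_card
    intro p hp
    simp only [Finset.mem_insert, Finset.mem_singleton] at hp
    rw [Finset.mem_filter, hA, Finset.mem_filter]
    rcases hp with rfl | rfl | rfl
    · refine ⟨⟨Finset.mem_univ _, h01, h12, h20⟩, ?_⟩
      ext v; simp only [Finset.mem_insert, Finset.mem_singleton, hs']
    · refine ⟨⟨Finset.mem_univ _, h12, h20, h01⟩, ?_⟩
      ext v; simp only [Finset.mem_insert, Finset.mem_singleton, hs']; tauto
    · refine ⟨⟨Finset.mem_univ _, h20, h01, h12⟩, ?_⟩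
      ext v; simp only [Finset.mem_insert, Finset.mem_singleton, hs']; tauto
  have h3 : B.card * 3 ≤ A.card := by
    calc B.card * 3 = ∑ s ∈ B, 3 := by simp
      _ ≤ ∑ s ∈ B, (A.filter fun p => ({p.1, p.2.1, p.2.2} : Finset V) = s).card :=
          Finset.sum_le_sum key
      _ ≤ A.card := by
        rw [Finset.sum_card_fiberwise_eq_card_filter]
        exact Finset.card_filter_le _ _
  have : ((B.card * 3 : ℕ) : ℝ) ≤ A.card := by exact_mod_cast h3
  push_cast at this
  linarith

theorem count_le {V : Type} [Fintype V] (r : V → V → Prop) (h : IsTournament r) :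
    (patternCount r C3rel : ℝ) ≤
        ((Fintype.card V : ℝ) ^ 3 - (Fintype.card V : ℝ)) / 24 := by
  have := three_count_le r h
  have := sum_cyc_le r h
  linarith

theorem trans_or_cyc {V : Type} (r : V → V → Prop) (h : IsTournament r)
    (s : Finset V) (hs : s.card = 3) : TransOn r s ∨ InducesPattern r C3rel s := by
  classical
  by_contra hcon
  push Not at hcon
  obtain ⟨ht, hp⟩ := hcon
  apply ht
  intro x hx y hy z hz hxy hyz
  by_contra hxz
  have h0 := h.1
  have h1 := h.2
  have nxy : x ≠ y := by rintro rfl; exact h0 _ hxy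
  have nyz : y ≠ z := by rintro rfl; exact h0 _ hyz
  have nxz : x ≠ z := by
    rintro rfl
    exact (h1 x y nxy).mp hxy hyz
  have hzx : r z x := by
    have := h1 x z nxz
    tauto
  apply hp
  have hsub : ({x, y, z} : Finset V) = s := by
    apply Finset.eq_of_subset_of_card_le
    · intro v hv
      simp only [Finset.mem_insert, Finset.mem_singleton] at hv
      rcases hv with rfl | rfl | rfl <;> assumption
    · rw [hs, Finset.card_eq_three.mpr ⟨x, y, z, nxy, nxz, nyz, rfl⟩]
  have a1 := (h1 x y nxy).mp hxy
  have a2 := (h1 y z nyz).mp hyz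
  refine ⟨![x, y, z], ?_, ?_, ?_⟩
  · intro i j hij
    fin_cases i <;> fin_cases j <;>
      simp [nxy, nyz, nxz, nxy.symm, nyz.symm, nxz.symm] at hij ⊢
  · rw [← hsub]
    ext v
    simp [eq_comm]
    tauto
  · intro i j
    fin_cases i <;> fin_cases j <;> simp [C3rel, *]

theorem choose_le {V : Type} [Fintype V] (r : V → V → Prop) (h : IsTournament r) :
    ((Fintype.card V).choose 3 : ℝ) - patternCount r C3rel ≤
      transDensity 3 r * ((Fintype.card V).choose 3 : ℝ) := by
  classical
  unfold transDensity
  by_cases hz : ((Fintype.card V).choose 3 : ℝ) = 0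
  · rw [hz]; simp
  rw [div_mul_cancel₀ _ hz, sub_le_iff_le_add]
  unfold patternCount
  norm_cast
  rw [← Finset.card_univ, ← Finset.card_powersetCard]
  refine le_trans (Finset.card_le_card ?_) (Finset.card_union_le _ _)
  intro s hs
  rw [Finset.mem_union, Finset.mem_filter, Finset.mem_filter]
  rcases trans_or_cyc r h s (Finset.mem_powersetCard.mp hs).2 with h | h
  · exact Or.inl ⟨hs, h⟩
  · exact Or.inr ⟨hs, h⟩

/-- Every tournament on `n` vertices has at most `(n³ - n)/24` cyclic triangles;
consequently every large tournament satisfies `t₃ ≥ 3/4 - ε`. -/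
theorem few_cyclic_triangles :
    (∀ (V : Type) [Fintype V] (r : V → V → Prop), IsTournament r →
      (patternCount r C3rel : ℝ) ≤
        ((Fintype.card V : ℝ) ^ 3 - (Fintype.card V : ℝ)) / 24) ∧
    ∀ ε : ℝ, 0 < ε → ∃ N : ℕ, ∀ (V : Type) [Fintype V] (r : V → V → Prop),
      IsTournament r → N ≤ Fintype.card V →
      3 / 4 - ε ≤ transDensity 3 r := by
  refine ⟨fun V _ r h => count_le r h, ?_⟩
  intro ε hε
  obtain ⟨k, hk⟩ := exists_nat_gt (1 / ε)
  refine ⟨k + 3, fun V _ r h hN => ?_⟩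
  have h1 := choose_le r h
  have h2 := count_le r h
  obtain ⟨m, hm⟩ := Nat.exists_eq_add_of_le hN
  have hc : ((Fintype.card V).choose 3 : ℝ) =
      (Fintype.card V : ℝ) * (Fintype.card V - 1) * (Fintype.card V - 2) / 6 := by
    rw [Nat.cast_choose_eq_ascPochhammer_div]
    have h3 : ((Fintype.card V - (3 - 1) : ℕ) : ℝ) = (Fintype.card V : ℝ) - 2 := by
      rw [Nat.cast_sub (by omega)]; norm_num
    rw [h3]
    simp [ascPochhammer_succ_right, Nat.factorial]
    ring
  rw [hc] at h1
  have hn : (Fintype.card V : ℝ) = k + 3 + m := by rw [hm]; push_cast; ring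
  generalize (Fintype.card V : ℝ) = n at *
  have hm0 : (0 : ℝ) ≤ m := Nat.cast_nonneg m
  have hk0 : (0 : ℝ) < k := lt_trans (by positivity) hk
  have hkε : 1 < k * ε := by rwa [div_lt_iff₀ hε] at hk
  have hp : 0 < n * (n - 1) := by apply mul_pos <;> linarith
  have h4 : n * (n - 1) * ((n - 2) / 6 - (n + 1) / 24) ≤
      n * (n - 1) * (transDensity 3 r * ((n - 2) / 6)) := by linarith
  have h5 := le_of_mul_le_mul_left h4 hp
  have h6 : 1 < (n - 2) * ε := by nlinarith
  by_contra hlt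
  push Not at hlt
  have : transDensity 3 r * (n - 2) < (3 / 4 - ε) * (n - 2) :=
    mul_lt_mul_of_pos_right hlt (by linarith)
  linarith
end

section
/- (Prömel–Rödl) For every a > 0 there exist b > 0 and N ∈ ℕ such that every finite simple graph G on n ≥ N vertices whose clique number ω(G) and independence number α(G) are both less than a·log n contains every graph on ⌊b·log n⌋ vertices as an induced subgraph. -/
open Finset

open Classical in
/-- Number of neighbours of `v` in `B`, as a real number. -/
noncomputable def prDeg {V : Type} (G : SimpleGraph V) (B : Finset V) (v : V) : ℝ :=
  ((B.filter (fun w => G.Adj v w)).card : ℝ)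

open Classical in
/-- Erdős–Szekeres bound. -/
theorem pr_ramsey {V : Type} (G : SimpleGraph V) : ∀ (s t : ℕ) (U : Finset V),
    (s + t).choose s ≤ U.card →
    (∃ I ⊆ U, Gᶜ.IsClique (I : Set V) ∧ I.card = s) ∨
    (∃ K ⊆ U, G.IsClique (K : Set V) ∧ K.card = t) := by
  intro s
  induction s with
  | zero => intro t U _; left; exact ⟨∅, by simp, by simp, by simp⟩
  | succ s ihs =>
    intro t
    induction t with
    | zero => intro U _; right; exact ⟨∅, by simp, by simp, by simp⟩
    | succ t iht =>
      intro U hU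
      have hch : (s + 1 + (t + 1)).choose (s + 1) =
          (s + (t + 1)).choose s + (s + 1 + t).choose (s + 1) := by
        have : s + 1 + (t + 1) = (s + (t + 1)) + 1 := by ring
        rw [this, Nat.choose_succ_succ]
        congr 2
        ring
      have hpos : 0 < (s + 1 + (t + 1)).choose (s + 1) := Nat.choose_pos (by omega)
      obtain ⟨v, hv⟩ : U.Nonempty := Finset.card_pos.mp (by omega)
      have hcard := Finset.card_erase_of_mem hv
      have hsplit := Finset.card_filter_add_card_filter_not (s := U.erase v) (fun w => G.Adj v w)
      by_cases h1 : (s + (t + 1)).choose s ≤ ((U.erase v).filter (fun w => ¬ G.Adj v w)).card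
      · rcases ihs (t + 1) _ h1 with ⟨I, hI, hc, hs⟩ | ⟨K, hK, hc, hs⟩
        · left
          have hvI : v ∉ I := fun h => by
            have := hI h
            simp at this
          refine ⟨insert v I, ?_, ?_, by rw [Finset.card_insert_of_notMem hvI, hs]⟩
          · intro w hw
            rcases Finset.mem_insert.mp hw with rfl | h
            · exact hv
            · have := hI h
              simp at this; exact this.1.2
          · rw [Finset.coe_insert, SimpleGraph.isClique_insert]
            refine ⟨hc, fun b hb hne => ?_⟩
            have := hI hb
            simp at this
            rw [SimpleGraph.compl_adj]
            exact ⟨hne, this.2⟩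
        · right
          refine ⟨K, fun w hw => ?_, hc, hs⟩
          have := hK hw
          simp at this; exact this.1.2
      · have h2 : (s + 1 + t).choose (s + 1) ≤ ((U.erase v).filter (fun w => G.Adj v w)).card := by
          omega
        rcases iht _ h2 with ⟨I, hI, hc, hs⟩ | ⟨K, hK, hc, hs⟩
        · left
          refine ⟨I, fun w hw => ?_, hc, hs⟩
          have := hI hw
          simp at this; exact this.1.2
        · right
          have hvI : v ∉ K := fun h => by
            have := hK h
            simp at this
          refine ⟨insert v K, ?_, ?_, by rw [Finset.card_insert_of_notMem hvI, hs]⟩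
          · intro w hw
            rcases Finset.mem_insert.mp hw with rfl | h
            · exact hv
            · have := hK h
              simp at this; exact this.1.2
          · rw [Finset.coe_insert, SimpleGraph.isClique_insert]
            refine ⟨hc, fun b hb hne => ?_⟩
            have := hK hb
            simp at this
            exact this.2

theorem pr_count {V : Type} (I : Finset V) (s : ℕ) (x : ℝ) (hx : 0 < x) (hx1 : x ≤ 1) :
    ((I.powerset.filter (fun T => T.card < s)).card : ℝ) * x ^ s ≤ (1 + x) ^ I.card := by
  have h1 : ∑ T ∈ I.powerset, x ^ T.card = (1 + x) ^ I.card := by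
    have := Finset.sum_pow_mul_eq_add_pow x 1 I
    simpa [add_comm] using this
  rw [← h1, ← nsmul_eq_mul, ← Finset.sum_const]
  calc ∑ T ∈ I.powerset.filter (fun T => T.card < s), x ^ s
      ≤ ∑ T ∈ I.powerset.filter (fun T => T.card < s), x ^ T.card := by
        apply Finset.sum_le_sum
        intro T hT
        exact pow_le_pow_of_le_one hx.le hx1 (Finset.mem_filter.mp hT).2.le
    _ ≤ _ := by
        apply Finset.sum_le_sum_of_subset_of_nonneg (Finset.filter_subset _ _)
        intros; positivity

theorem pr_choose (s t : ℕ) (x : ℝ) (hx : 0 < x) :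
    ((s + t).choose s : ℝ) * x ^ s ≤ (1 + x) ^ (s + t) := by
  rw [add_comm 1 x, add_pow]
  have := Finset.single_le_sum (f := fun m => x ^ m * 1 ^ (s + t - m) * ((s + t).choose m : ℝ))
    (s := Finset.range (s + t + 1)) (fun i _ => by positivity)
    (Finset.mem_range.mpr (show s < s + t + 1 by omega))
  simp only [one_pow, mul_one] at this ⊢
  linarith

open Classical in
/-- Erdős–Szemerédi step. -/
theorem pr_es {V : Type} (G : SimpleGraph V) (X : Finset V) (s t : ℕ) (ε x : ℝ)
    (hε : 0 < ε) (hs : 0 < s) (hx : 0 < x) (hx1 : x ≤ 1) (hX : 0 < X.card)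
    (he : ∑ v ∈ X, prDeg G X v ≤ ε * (X.card : ℝ) ^ 2)
    (hst : 8 * (t : ℝ) * ε ≤ s)
    (hind : ∀ I : Finset V, Gᶜ.IsClique (I : Set V) → I.card < t)
    (hcl : ∀ I : Finset V, G.IsClique (I : Set V) → I.card < t)
    (hbig : (1 + x) ^ (s + 2 * t) < x ^ (2 * s) * ((X.card : ℝ) / 4 - t)) : False := by
  simp only [prDeg] at he
  have hN : (0 : ℝ) < X.card := by exact_mod_cast hX
  set N : ℝ := ((X.card : ℕ) : ℝ) with hNdef
  set d : V → ℝ := fun v => ((X.filter (fun w => G.Adj v w)).card : ℝ) with hd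
  set Z := X.filter (fun v => d v ≤ 2 * ε * N) with hZ
  have hZX : Z ⊆ X := Finset.filter_subset _ _
  have hZcard : N / 2 ≤ Z.card := by
    have h1 := Finset.card_filter_add_card_filter_not (s := X) (fun v => d v ≤ 2 * ε * N)
    have h2 : ((X.filter (fun v => ¬ d v ≤ 2 * ε * N)).card : ℝ) * (2 * ε * N) ≤ ε * N ^ 2 := by
      rw [← nsmul_eq_mul, ← Finset.sum_const]
      refine le_trans (le_trans (Finset.sum_le_sum (g := d) fun v hv => ?_) ?_) he
      · have := (Finset.mem_filter.mp hv).2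
        linarith
      · apply Finset.sum_le_sum_of_subset_of_nonneg (Finset.filter_subset _ _)
        intros; simp only [hd]; positivity
    have h3 : ((X.filter (fun v => ¬ d v ≤ 2 * ε * N)).card : ℝ) ≤ N / 2 := by
      have : 0 < 2 * ε * N := by positivity
      rw [← mul_le_mul_iff_left₀ this]
      nlinarith
    have h4 : (Z.card : ℝ) + ((X.filter (fun v => ¬ d v ≤ 2 * ε * N)).card : ℝ) = N := by
      have h5 : (((X.filter (fun v => d v ≤ 2 * ε * N)).card +
        (X.filter (fun v => ¬ d v ≤ 2 * ε * N)).card : ℕ) : ℝ) = N := by rw [h1]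
      push_cast at h5
      exact h5
    linarith
  obtain ⟨I, hI, hmax⟩ := Finset.exists_max_image
    (Z.powerset.filter (fun I : Finset V => Gᶜ.IsClique (I : Set V))) Finset.card ⟨∅, by simp⟩
  obtain ⟨hIZ, hIc⟩ := Finset.mem_filter.mp hI
  rw [Finset.mem_powerset] at hIZ
  have hIt := hind I hIc
  have hItR : (I.card : ℝ) ≤ t := by exact_mod_cast hIt.le
  set Bad := Z.filter (fun v => s ≤ (I.filter (fun u => G.Adj v u)).card) with hBad
  have hBadc : (Bad.card : ℝ) ≤ N / 4 := by
    have h1 : (Bad.card : ℝ) * s ≤ I.card * (2 * ε * N) := by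
      calc (Bad.card : ℝ) * s ≤ ∑ v ∈ Bad, ((I.filter (fun u => G.Adj v u)).card : ℝ) := by
            rw [← nsmul_eq_mul, ← Finset.sum_const]
            apply Finset.sum_le_sum
            intro v hv
            exact_mod_cast (Finset.mem_filter.mp hv).2
        _ ≤ ∑ v ∈ X, ((I.filter (fun u => G.Adj v u)).card : ℝ) := by
            apply Finset.sum_le_sum_of_subset_of_nonneg
              ((Finset.filter_subset _ _).trans hZX)
            intros; positivity
        _ = ∑ u ∈ I, ((X.filter (fun v => G.Adj u v)).card : ℝ) := by
            simp only [Finset.card_filter]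
            push_cast
            rw [Finset.sum_comm]
            simp only [SimpleGraph.adj_comm]
        _ ≤ ∑ u ∈ I, (2 * ε * N) := by
            apply Finset.sum_le_sum
            intro u hu
            exact (Finset.mem_filter.mp (hIZ hu)).2
        _ = _ := by simp
    have hs' : (0 : ℝ) < s := by exact_mod_cast hs
    rw [← mul_le_mul_iff_left₀ hs']
    have : (I.card : ℝ) * (2 * ε * N) ≤ t * (2 * ε * N) := by gcongr
    have h5 : 8 * (t : ℝ) * ε * N ≤ s * N := by gcongr
    nlinarith
  set Good := (Z \ Bad) \ I with hGood
  have hGoodc : N / 4 - t ≤ Good.card := by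
    have h1 : Z.card ≤ (Z \ Bad).card + Bad.card := by
      have := Finset.le_card_sdiff Bad Z; omega
    have h2 : (Z \ Bad).card ≤ Good.card + I.card := by
      rw [hGood]
      have := Finset.le_card_sdiff I (Z \ Bad); omega
    have h1' : (Z.card : ℝ) ≤ (Z \ Bad).card + Bad.card := by exact_mod_cast h1
    have h2' : ((Z \ Bad).card : ℝ) ≤ Good.card + I.card := by exact_mod_cast h2
    linarith
  set P := I.powerset.filter (fun T => T.card < s) with hP
  have hmaps : ∀ v ∈ Good, I.filter (fun u => G.Adj v u) ∈ P := by
    intro v hv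
    rw [hGood, Finset.mem_sdiff, Finset.mem_sdiff] at hv
    rw [hP, Finset.mem_filter, Finset.mem_powerset]
    refine ⟨Finset.filter_subset _ _, ?_⟩
    by_contra hcon
    exact hv.1.2 (Finset.mem_filter.mpr ⟨hv.1.1, not_lt.mp hcon⟩)
  have hPC : P.card * (s + t).choose s < Good.card := by
    have h1 := pr_count I s x hx hx1
    have h2 := pr_choose s t x hx
    have h3 : ((P.card : ℝ) * ((s + t).choose s : ℝ)) * x ^ (2 * s) ≤ (1 + x) ^ (s + 2 * t) := by
      calc ((P.card : ℝ) * ((s + t).choose s : ℝ)) * x ^ (2 * s)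
          = ((P.card : ℝ) * x ^ s) * (((s + t).choose s : ℝ) * x ^ s) := by ring
        _ ≤ (1 + x) ^ I.card * (1 + x) ^ (s + t) := by gcongr
        _ ≤ (1 + x) ^ t * (1 + x) ^ (s + t) := by
            gcongr
            linarith
        _ = _ := by ring
    have h4 : (0 : ℝ) < x ^ (2 * s) := by positivity
    have h5 : (P.card : ℝ) * ((s + t).choose s : ℝ) < N / 4 - t := by
      rw [← mul_lt_mul_iff_left₀ h4]
      linarith
    have : (P.card : ℝ) * ((s + t).choose s : ℝ) < Good.card := lt_of_lt_of_le h5 hGoodc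
    exact_mod_cast this
  obtain ⟨T, hT, hF⟩ := Finset.exists_lt_card_fiber_of_mul_lt_card_of_maps_to hmaps hPC
  obtain ⟨hTI, hTs⟩ := Finset.mem_filter.mp hT
  rw [Finset.mem_powerset] at hTI
  rcases pr_ramsey G s t _ hF.le with ⟨S, hS, hSc, hScard⟩ | ⟨K, _, hKc, hKcard⟩
  · have hSG : ∀ v ∈ S, v ∈ Z ∧ v ∉ I ∧ I.filter (fun u => G.Adj v u) = T := by
      intro v hv
      have := Finset.mem_filter.mp (hS hv)
      rw [hGood, Finset.mem_sdiff, Finset.mem_sdiff] at this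
      exact ⟨this.1.1.1, this.1.2, this.2⟩
    have hnon : ∀ v ∈ S, ∀ u ∈ I \ T, ¬ G.Adj v u := by
      intro v hv u hu hadj
      rw [Finset.mem_sdiff] at hu
      apply hu.2
      rw [← (hSG v hv).2.2]
      exact Finset.mem_filter.mpr ⟨hu.1, hadj⟩
    have hdisj : Disjoint (I \ T) S := by
      rw [Finset.disjoint_left]
      intro v hv hvS
      exact (hSG v hvS).2.1 (Finset.mem_sdiff.mp hv).1
    have hmem : (I \ T) ∪ S ∈ Z.powerset.filter (fun I : Finset V => Gᶜ.IsClique (I : Set V)) := by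
      rw [Finset.mem_filter, Finset.mem_powerset]
      constructor
      · apply Finset.union_subset (Finset.sdiff_subset.trans hIZ)
        exact fun v hv => (hSG v hv).1
      · intro u hu v hv huv
        rw [Finset.mem_coe, Finset.mem_union] at hu hv
        rcases hu with hu | hu <;> rcases hv with hv | hv
        · exact hIc (Finset.mem_coe.mpr (Finset.mem_sdiff.mp hu).1)
            (Finset.mem_coe.mpr (Finset.mem_sdiff.mp hv).1) huv
        · rw [SimpleGraph.compl_adj]
          exact ⟨huv, fun h => hnon v hv u hu h.symm⟩
        · rw [SimpleGraph.compl_adj]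
          exact ⟨huv, fun h => hnon u hu v hv h⟩
        · exact hSc (Finset.mem_coe.mpr hu) (Finset.mem_coe.mpr hv) huv
    have h1 := hmax _ hmem
    rw [Finset.card_union_of_disjoint hdisj, Finset.card_sdiff_of_subset hTI] at h1
    have := Finset.card_le_card hTI
    omega
  · have := hcl K hKc
    omega

open Classical in
/-- Greedy embedding. -/
theorem pr_embed {V : Type} (G : SimpleGraph V) (U : Finset V) (ε L : ℝ) (hε : 0 < ε)
    (hε1 : ε ≤ 1) (hL : 0 < L)
    (hG : ∀ (P : Prop) (A B : Finset V), A ⊆ U → B ⊆ U → Disjoint A B →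
      L ≤ A.card → L ≤ B.card →
      ∃ v ∈ A, ε * B.card < ((B.filter (fun w => P ↔ G.Adj v w)).card : ℝ)) :
    ∀ (k : ℕ) (H : SimpleGraph (Fin k)) (W : Fin k → Finset V), (∀ i, W i ⊆ U) →
      (∀ i j, i ≠ j → Disjoint (W i) (W j)) → (∀ i, k * L ≤ ε ^ k * (W i).card) →
      ∃ f : Fin k → V, (∀ i, f i ∈ W i) ∧ ∀ i j, i ≠ j → (H.Adj i j ↔ G.Adj (f i) (f j)) := by
  intro k
  induction k with
  | zero =>
    intro H W _ _ _
    exact ⟨fun i => i.elim0, fun i => i.elim0, fun i => i.elim0⟩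
  | succ k ih =>
    intro H W hWU hWd hWc
    have hbig : ∀ i, (k + 1 : ℝ) * L ≤ (W i).card := by
      intro i
      have h1 := hWc i
      push_cast at h1
      refine h1.trans ?_
      have : ε ^ (k + 1) ≤ 1 := pow_le_one₀ hε.le hε1
      have h2 : (0 : ℝ) ≤ (W i).card := by positivity
      nlinarith
    have hk0 : (0 : ℝ) ≤ k := by positivity
    have hbigL : ∀ i, L ≤ (W i).card := fun i => by
      have := hbig i
      nlinarith
    set N : V → Fin k → Finset V := fun v j =>
      (W j.succ).filter (fun w => H.Adj 0 j.succ ↔ G.Adj v w) with hN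
    set Bad : Fin k → Finset V := fun j =>
      (W 0).filter (fun v => ((N v j).card : ℝ) ≤ ε * (W j.succ).card) with hBad
    have hBadc : ∀ j, ((Bad j).card : ℝ) ≤ L := by
      intro j
      by_contra hcon
      push Not at hcon
      obtain ⟨v, hv, hlt⟩ := hG (H.Adj 0 j.succ) (Bad j) (W j.succ)
        ((Finset.filter_subset _ _).trans (hWU 0)) (hWU _)
        (Disjoint.mono_left (Finset.filter_subset _ _) (hWd 0 j.succ (Fin.succ_ne_zero j).symm))
        hcon.le (hbigL _)
      have := (Finset.mem_filter.mp hv).2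
      simp only [hN] at this
      linarith
    obtain ⟨v, hv, hvgood⟩ : ∃ v ∈ W 0, ∀ j, v ∉ Bad j := by
      by_contra hcon
      push Not at hcon
      have hsub : W 0 ⊆ Finset.univ.biUnion Bad := by
        intro v hv
        obtain ⟨j, hj⟩ := hcon v hv
        exact Finset.mem_biUnion.mpr ⟨j, Finset.mem_univ _, hj⟩
      have h1 : (W 0).card ≤ ∑ j, (Bad j).card :=
        (Finset.card_le_card hsub).trans Finset.card_biUnion_le
      have h2 : ((W 0).card : ℝ) ≤ ∑ j, ((Bad j).card : ℝ) := by exact_mod_cast h1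
      have h3 : ∑ j, ((Bad j).card : ℝ) ≤ ∑ j : Fin k, L := Finset.sum_le_sum fun j _ => hBadc j
      simp at h3
      have := hbig 0
      nlinarith
    have hNc : ∀ j, ε * (W j.succ).card < (N v j).card := by
      intro j
      by_contra hcon
      exact hvgood j (Finset.mem_filter.mpr ⟨hv, not_lt.mp hcon⟩)
    have hNW : ∀ j, N v j ⊆ W j.succ := fun j => Finset.filter_subset _ _
    obtain ⟨f, hf, hfH⟩ := ih (H.comap Fin.succ) (N v) (fun j => (hNW j).trans (hWU _))
      (fun i j hij => Disjoint.mono (hNW i) (hNW j)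
        (hWd _ _ (fun h => hij (Fin.succ_injective _ h))))
      (fun j => by
        have h1 := hWc j.succ
        have h2 := hNc j
        have h3 : ε ^ k * (ε * (W j.succ).card) ≤ ε ^ k * (N v j).card := by gcongr
        push_cast at h1
        rw [pow_succ] at h1
        nlinarith)
    have hf0 : ∀ j : Fin k, (H.Adj 0 j.succ ↔ G.Adj v (f j)) := fun j =>
      (Finset.mem_filter.mp (hf j)).2
    refine ⟨Fin.cons v f, ?_, ?_⟩
    · intro i
      refine Fin.cases ?_ (fun j => ?_) i
      · simpa using hv
      · simpa using hNW j (hf j)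
    · intro i j
      refine Fin.cases ?_ (fun i => ?_) i <;> refine Fin.cases ?_ (fun j => ?_) j
      · intro h; exact absurd rfl h
      · intro _; simpa using hf0 j
      · intro _
        have := hf0 i
        rw [SimpleGraph.adj_comm, G.adj_comm] at this
        simpa using this
      · intro hij
        have := hfH i j (fun h => hij (by rw [h]))
        simpa using this

open Classical in
theorem pr_split {V : Type} (q : ℕ) : ∀ (k : ℕ) (U : Finset V), k * q ≤ U.card →
    ∃ W : Fin k → Finset V, (∀ i, W i ⊆ U) ∧ (∀ i j, i ≠ j → Disjoint (W i) (W j)) ∧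
      ∀ i, (W i).card = q := by
  intro k
  induction k with
  | zero => intro U _; exact ⟨fun i => i.elim0, fun i => i.elim0, fun i => i.elim0, fun i => i.elim0⟩
  | succ k ih =>
    intro U hU
    have hU' : k * q + q ≤ U.card := by rw [← Nat.succ_mul]; exact hU
    obtain ⟨A, hA, hAc⟩ := Finset.exists_subset_card_eq (s := U) (n := q) (by omega)
    obtain ⟨W, hW, hWd, hWc⟩ := ih (U \ A) (by
      rw [Finset.card_sdiff_of_subset hA]; omega)
    refine ⟨Fin.cons A W, ?_, ?_, ?_⟩
    · intro i
      refine Fin.cases ?_ (fun j => ?_) i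
      · simpa using hA
      · simpa using (hW j).trans Finset.sdiff_subset
    · have key : ∀ j, Disjoint A (W j) := fun j =>
        Disjoint.mono_right (hW j) Finset.disjoint_sdiff
      intro i j
      refine Fin.cases ?_ (fun i => ?_) i <;> refine Fin.cases ?_ (fun j => ?_) j
      · intro h; exact absurd rfl h
      · intro _; simpa using key j
      · intro _; simpa using (key i).symm
      · intro hij; simpa using hWd i j (fun h => hij (by rw [h]))
    · intro i
      refine Fin.cases ?_ (fun j => ?_) i
      · simpa using hAc
      · simpa using hWc j

open Classical in
theorem pr_pair {V : Type} (G : SimpleGraph V) (ε : ℝ) (hε : 0 < ε)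
    (hε1 : ε ≤ 1) (k : ℕ) (hk : 0 < k) (H : SimpleGraph (Fin k))
    (hH : ¬ ∃ f : Fin k → V, Function.Injective f ∧ ∀ i j, H.Adj i j ↔ G.Adj (f i) (f j))
    (U : Finset V) (hU : k ≤ U.card) :
    ∃ A B : Finset V, A ⊆ U ∧ B ⊆ U ∧ Disjoint A B ∧
      (ε / 8) ^ k * U.card ≤ A.card ∧ (ε / 8) ^ k * U.card ≤ B.card ∧
      ((∀ v ∈ A, prDeg G B v ≤ ε * B.card) ∨
       (∀ v ∈ A, prDeg Gᶜ B v ≤ ε * B.card)) := by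
  by_contra hcon
  push Not at hcon
  simp only [prDeg] at hcon
  apply hH
  have hU0 : (0 : ℝ) < U.card := by exact_mod_cast lt_of_lt_of_le hk hU
  set L : ℝ := (ε / 8) ^ k * U.card with hLdef
  have hL : 0 < L := by positivity
  obtain ⟨W, hWU, hWd, hWc⟩ := pr_split (U.card / k) k U (Nat.mul_div_le _ _)
  have hq : (U.card : ℝ) ≤ 2 * k * (U.card / k : ℕ) := by
    have h1 := Nat.div_add_mod U.card k
    have h2 := Nat.mod_lt U.card hk
    have h3 : 1 ≤ U.card / k := (Nat.one_le_div_iff hk).mpr hU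
    have h4 : U.card ≤ 2 * k * (U.card / k) := by nlinarith
    exact_mod_cast h4
  obtain ⟨f, hf, hfH⟩ := pr_embed G U ε L hε hε1 hL (by
    intro P A B hA hB hAB hAc hBc
    obtain ⟨h1, h2⟩ := hcon A B hA hB hAB hAc hBc
    by_cases hP : P
    · obtain ⟨v, hv, h⟩ := h1
      refine ⟨v, hv, ?_⟩
      simpa [hP] using h
    · obtain ⟨v, hv, h⟩ := h2
      refine ⟨v, hv, lt_of_lt_of_le h ?_⟩
      norm_cast
      apply Finset.card_le_card
      intro w hw
      have hw' := (@Finset.mem_filter _ _ (_) _ _).mp hw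
      rw [SimpleGraph.compl_adj] at hw'
      rw [Finset.mem_filter]
      exact ⟨hw'.1, by simp [hP, hw'.2.2]⟩) k H W hWU hWd (by
    intro i
    rw [hWc i, hLdef, div_pow]
    have h8 : (2 * k * k : ℝ) ≤ 8 ^ k := by
      have h1 : k ≤ 2 ^ k := Nat.lt_two_pow_self.le
      have h2 : 2 ≤ 2 ^ k := by
        calc 2 = 2 ^ 1 := rfl
          _ ≤ 2 ^ k := Nat.pow_le_pow_right (by norm_num) hk
      have h3 : 2 * k * k ≤ 2 ^ k * 2 ^ k * 2 ^ k := by gcongr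
      have h4 : 2 ^ k * 2 ^ k * 2 ^ k = 8 ^ k := by
        rw [← mul_pow, ← mul_pow]; norm_num
      rw [h4] at h3
      exact_mod_cast h3
    have hεk : 0 < ε ^ k := by positivity
    have h80 : (0 : ℝ) < 8 ^ k := by positivity
    calc (k : ℝ) * (ε ^ k / 8 ^ k * U.card)
        ≤ k * (ε ^ k / 8 ^ k * (2 * k * (U.card / k : ℕ))) := by gcongr
      _ = ε ^ k * (U.card / k : ℕ) * ((2 * k * k) / 8 ^ k) := by ring
      _ ≤ ε ^ k * (U.card / k : ℕ) * 1 := by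
        gcongr
        rw [div_le_one h80]; exact h8
      _ = _ := by ring)
  refine ⟨f, ?_, ?_⟩
  · intro i j hij
    by_contra hne
    exact Finset.disjoint_left.mp (hWd i j hne) (hf i) (hij ▸ hf j)
  · intro i j
    by_cases h : i = j
    · subst h; simp
    · exact hfH i j h

open Classical in
theorem pr_combine {V : Type} (G : SimpleGraph V) (ε : ℝ) (hε : 0 < ε) (p : ℕ)
    (A B X : Finset V) (hAB : Disjoint A B) (hX : X ⊆ A) (hX0 : 0 < X.card)
    (hdeg : ∀ v ∈ A, prDeg G B v ≤ ε * B.card)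
    (hsp : ∑ v ∈ X, prDeg G X v
      ≤ ((1 / 2) ^ p + 2 * ε) * (X.card : ℝ) ^ 2) :
    ∃ B' ⊆ B, (B.card : ℝ) / 2 ≤ B'.card ∧ ∀ Y ⊆ B', Y.card = X.card →
      ∑ v ∈ Y, prDeg G Y v
        ≤ ((1 / 2) ^ p + 2 * ε) * (Y.card : ℝ) ^ 2 →
      (X ∪ Y).card = 2 * X.card ∧
      ∑ v ∈ X ∪ Y, prDeg G (X ∪ Y) v
        ≤ ((1 / 2) ^ (p + 1) + 2 * ε) * ((X ∪ Y).card : ℝ) ^ 2 := by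
  simp only [prDeg] at hdeg hsp ⊢
  have hM : (0 : ℝ) < X.card := by exact_mod_cast hX0
  set M : ℝ := ((X.card : ℕ) : ℝ) with hMdef
  have hcount : ∀ C D : Finset V, ∑ v ∈ C, ((D.filter (fun w => G.Adj v w)).card : ℝ) =
      ∑ w ∈ D, ((C.filter (fun v => G.Adj w v)).card : ℝ) := by
    intro C D
    simp only [Finset.card_filter]
    push_cast
    rw [Finset.sum_comm]
    simp only [SimpleGraph.adj_comm]
  set e : V → ℝ := fun w => ((X.filter (fun v => G.Adj w v)).card : ℝ) with he
  refine ⟨B.filter (fun w => e w ≤ 2 * ε * M), Finset.filter_subset _ _, ?_, ?_⟩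
  · have h1 := Finset.card_filter_add_card_filter_not (s := B) (fun w => e w ≤ 2 * ε * M)
    have h2 : ((B.filter (fun v => ¬ e v ≤ 2 * ε * M)).card : ℝ) * (2 * ε * M)
        ≤ M * (ε * B.card) := by
      calc _ ≤ ∑ w ∈ B.filter (fun v => ¬ e v ≤ 2 * ε * M), e w := by
            rw [← nsmul_eq_mul, ← Finset.sum_const]
            apply Finset.sum_le_sum
            intro v hv
            have := (Finset.mem_filter.mp hv).2
            linarith
        _ ≤ ∑ w ∈ B, e w := by
            apply Finset.sum_le_sum_of_subset_of_nonneg (Finset.filter_subset _ _)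
            intros; simp only [he]; positivity
        _ = ∑ v ∈ X, ((B.filter (fun w => G.Adj v w)).card : ℝ) := (hcount X B).symm
        _ ≤ ∑ v ∈ X, ε * B.card := Finset.sum_le_sum fun v hv => hdeg v (hX hv)
        _ = _ := by simp [hMdef]
    have h3 : ((B.filter (fun v => ¬ e v ≤ 2 * ε * M)).card : ℝ) ≤ B.card / 2 := by
      have : 0 < 2 * ε * M := by positivity
      rw [← mul_le_mul_iff_left₀ this]
      nlinarith
    have h4 : ((B.filter (fun v => e v ≤ 2 * ε * M)).card : ℝ) +
        ((B.filter (fun v => ¬ e v ≤ 2 * ε * M)).card : ℝ) = B.card := by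
      exact_mod_cast h1
    linarith
  · intro Y hY hYc hYs
    have hXY : Disjoint X Y :=
      Disjoint.mono hX (hY.trans (Finset.filter_subset _ _)) hAB
    have hc : (X ∪ Y).card = 2 * X.card := by
      rw [Finset.card_union_of_disjoint hXY, hYc]; ring
    refine ⟨hc, ?_⟩
    have hfil : ∀ v, (((X ∪ Y).filter (fun w => G.Adj v w)).card : ℝ) =
        (X.filter (fun w => G.Adj v w)).card + (Y.filter (fun w => G.Adj v w)).card := by
      intro v
      rw [Finset.filter_union, Finset.card_union_of_disjoint]
      · push_cast; rfl
      · exact Disjoint.mono (Finset.filter_subset _ _) (Finset.filter_subset _ _) hXY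
    have hYX : ∑ v ∈ Y, ((X.filter (fun w => G.Adj v w)).card : ℝ) ≤ M * (2 * ε * M) := by
      calc _ ≤ ∑ v ∈ Y, 2 * ε * M :=
            Finset.sum_le_sum fun v hv => (Finset.mem_filter.mp (hY hv)).2
        _ = _ := by simp [hYc, hMdef]
    have hXYs : ∑ v ∈ X, ((Y.filter (fun w => G.Adj v w)).card : ℝ) ≤ M * (2 * ε * M) := by
      rw [hcount]; exact hYX
    rw [hc, Finset.sum_union hXY]
    simp only [hfil, Finset.sum_add_distrib]
    rw [hYc] at hYs
    push_cast
    rw [← hMdef] at hYs ⊢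
    rw [pow_succ]
    nlinarith

open Classical in
theorem pr_claim {V : Type} (G : SimpleGraph V) (ε : ℝ) (hε : 0 < ε)
    (hε1 : ε ≤ 1) (k : ℕ) (hk : 0 < k) (H : SimpleGraph (Fin k))
    (hH : ¬ ∃ f : Fin k → V, Function.Injective f ∧ ∀ i j, H.Adj i j ↔ G.Adj (f i) (f j))
    (m : ℕ) (hm : 0 < m) : ∀ (j p q : ℕ), p + q = j → ∀ U : Finset V,
    (4 * (8 / ε) ^ k) ^ j * (m : ℝ) ≤ U.card →
    ∃ X ⊆ U, (X.card = 2 ^ p * m ∧ ∑ v ∈ X, prDeg G X v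
        ≤ ((1 / 2) ^ p + 2 * ε) * (X.card : ℝ) ^ 2) ∨
      (X.card = 2 ^ q * m ∧ ∑ v ∈ X, prDeg Gᶜ X v
        ≤ ((1 / 2) ^ q + 2 * ε) * (X.card : ℝ) ^ 2) := by
  have hm1 : (1 : ℝ) ≤ m := by exact_mod_cast hm
  have h8e : (8 : ℝ) ≤ 8 / ε := by rw [le_div_iff₀ hε]; nlinarith
  set R : ℝ := (8 / ε) ^ k with hR
  have hR1 : 1 ≤ R := one_le_pow₀ (by linarith)
  have hRk : (k : ℝ) ≤ R := by
    have h1 : (k : ℝ) ≤ 2 ^ k := by exact_mod_cast Nat.lt_two_pow_self.le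
    exact h1.trans (pow_le_pow_left₀ (by norm_num) (by linarith) k)
  have hRinv : (ε / 8) ^ k * R = 1 := by
    rw [hR, ← mul_pow]
    have : ε / 8 * (8 / ε) = 1 := by field_simp
    rw [this, one_pow]
  have hQ1 : 1 ≤ 4 * R := by linarith
  have htriv : ∀ (G' : SimpleGraph V) (X : Finset V),
      ∑ v ∈ X, prDeg G' X v
        ≤ ((1 / 2) ^ 0 + 2 * ε) * (X.card : ℝ) ^ 2 := by
    intro G' X
    calc _ ≤ ∑ v ∈ X, (X.card : ℝ) := by
          apply Finset.sum_le_sum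
          intro v _
          simp only [prDeg]
          exact_mod_cast Finset.card_le_card (Finset.filter_subset _ _)
      _ = (X.card : ℝ) ^ 2 := by simp; ring
      _ ≤ _ := by
        have : (0 : ℝ) ≤ (X.card : ℝ) ^ 2 := by positivity
        rw [pow_zero]
        nlinarith
  intro j
  induction j with
  | zero =>
    intro p q hpq U hU
    obtain ⟨rfl, rfl⟩ : p = 0 ∧ q = 0 := by omega
    rw [pow_zero, one_mul] at hU
    obtain ⟨X, hX, hXc⟩ := Finset.exists_subset_card_eq (s := U) (n := m) (by exact_mod_cast hU)
    exact ⟨X, hX, Or.inl ⟨by simp [hXc], htriv G X⟩⟩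
  | succ j ih =>
    intro p q hpq U hU
    have hmU : m ≤ U.card := by
      have : (m : ℝ) ≤ U.card := by
        refine le_trans ?_ hU
        have : 1 ≤ (4 * R) ^ (j + 1) := one_le_pow₀ hQ1
        nlinarith
      exact_mod_cast this
    obtain ⟨X, hX, hXc⟩ := Finset.exists_subset_card_eq hmU
    rcases Nat.eq_zero_or_pos p with rfl | hp
    · exact ⟨X, hX, Or.inl ⟨by simp [hXc], htriv G X⟩⟩
    rcases Nat.eq_zero_or_pos q with rfl | hq
    · exact ⟨X, hX, Or.inr ⟨by simp [hXc], htriv Gᶜ X⟩⟩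
    clear hXc hX X
    have hQj : 1 ≤ (4 * R) ^ j := one_le_pow₀ hQ1
    have hkU : k ≤ U.card := by
      have : (k : ℝ) ≤ U.card := by
        refine le_trans ?_ hU
        rw [pow_succ]
        have : 1 * R * 1 ≤ (4 * R) ^ j * (4 * R) * m := by
          gcongr
          linarith
        linarith
      exact_mod_cast this
    obtain ⟨A, B, hA, hB, hAB, hAc, hBc, hor⟩ := pr_pair G ε hε hε1 k hk H hH U hkU
    have hc : 4 * ((4 * R) ^ j * m) ≤ (ε / 8) ^ k * U.card := by
      calc 4 * ((4 * R) ^ j * m) = ((ε / 8) ^ k * R) * (4 * ((4 * R) ^ j * m)) := by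
            rw [hRinv, one_mul]
        _ = (ε / 8) ^ k * ((4 * R) ^ (j + 1) * m) := by ring
        _ ≤ _ := by gcongr
    have hpos : 0 ≤ (4 * R) ^ j * m := by positivity
    rcases hor with hdeg | hdeg
    · obtain ⟨p, rfl⟩ : ∃ p', p = p' + 1 := ⟨p - 1, by omega⟩
      obtain ⟨X, hX, ⟨hXc, hXs⟩ | hd⟩ := ih p q (by omega) A (by linarith)
      swap
      · exact ⟨X, hX.trans hA, Or.inr hd⟩
      obtain ⟨B', hB', hB'c, hcomb⟩ := pr_combine G ε hε p A B X hAB hX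
        (by rw [hXc]; positivity) hdeg hXs
      obtain ⟨Y, hY, ⟨hYc, hYs⟩ | hd⟩ := ih p q (by omega) B' (by linarith)
      swap
      · exact ⟨Y, (hY.trans hB').trans hB, Or.inr hd⟩
      obtain ⟨h1, h2⟩ := hcomb Y hY (by rw [hXc, hYc]) hYs
      refine ⟨X ∪ Y, Finset.union_subset (hX.trans hA) ((hY.trans hB').trans hB), Or.inl ⟨?_, h2⟩⟩
      rw [h1, hXc]; ring
    · obtain ⟨q, rfl⟩ : ∃ p', q = p' + 1 := ⟨q - 1, by omega⟩
      obtain ⟨X, hX, hd | ⟨hXc, hXs⟩⟩ := ih p q (by omega) A (by linarith)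
      · exact ⟨X, hX.trans hA, Or.inl hd⟩
      obtain ⟨B', hB', hB'c, hcomb⟩ := pr_combine Gᶜ ε hε q A B X hAB hX
        (by rw [hXc]; positivity) hdeg hXs
      obtain ⟨Y, hY, hd | ⟨hYc, hYs⟩⟩ := ih p q (by omega) B' (by linarith)
      · exact ⟨Y, (hY.trans hB').trans hB, Or.inl hd⟩
      obtain ⟨h1, h2⟩ := hcomb Y hY (by rw [hXc, hYc]) hYs
      refine ⟨X ∪ Y, Finset.union_subset (hX.trans hA) ((hY.trans hB').trans hB), Or.inr ⟨?_, h2⟩⟩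
      rw [h1, hXc]; ring

set_option maxHeartbeats 1000000 in
theorem promel_rodl :
    ∀ a : ℝ, 0 < a → ∃ b : ℝ, 0 < b ∧ ∃ N : ℕ,
      ∀ (V : Type) [Fintype V] (G : SimpleGraph V),
        N ≤ Fintype.card V →
        (∀ s : Finset V, G.IsClique (s : Set V) →
          (s.card : ℝ) < a * Real.log (Fintype.card V)) →
        (∀ s : Finset V, Gᶜ.IsClique (s : Set V) →
          (s.card : ℝ) < a * Real.log (Fintype.card V)) →
        ∀ H : SimpleGraph (Fin ⌊b * Real.log (Fintype.card V)⌋₊),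
          ∃ f : Fin ⌊b * Real.log (Fintype.card V)⌋₊ → V, Function.Injective f ∧
            ∀ i j, H.Adj i j ↔ G.Adj (f i) (f j) := by
  intro a ha
  -- constants
  obtain ⟨x, hxdef⟩ : ∃ x : ℝ, x = 1 / (24 * (a + 1)) := ⟨_, rfl⟩
  have hx0 : 0 < x := by rw [hxdef]; positivity
  have hx24 : x ≤ 1 / 24 := by
    rw [hxdef]
    apply one_div_le_one_div_of_le <;> linarith
  have hxa : x * (3 * (a + 1)) = 1 / 8 := by rw [hxdef]; field_simp; norm_num
  obtain ⟨l, hldef⟩ : ∃ l : ℝ, l = Real.log (1 / x) := ⟨_, rfl⟩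
  have hl1 : 1 ≤ l := by
    rw [hldef, Real.le_log_iff_exp_le (by positivity), le_div_iff₀ hx0]
    have := Real.exp_one_lt_d9
    nlinarith
  have hxl : x = Real.exp (-l) := by
    rw [hldef, one_div, Real.log_inv, neg_neg, Real.exp_log hx0]
  obtain ⟨β, hβdef⟩ : ∃ β : ℝ, β = 1 / (16 * l) := ⟨_, rfl⟩
  have hβ0 : 0 < β := by rw [hβdef]; positivity
  have hβ1 : β ≤ 1 := by
    rw [hβdef, div_le_one (by positivity)]; linarith
  have hβl : 2 * β * l = 1 / 8 := by rw [hβdef]; field_simp; norm_num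
  obtain ⟨ε', hε'def⟩ : ∃ e : ℝ, e = β / (16 * (a + 1)) := ⟨_, rfl⟩
  have hε'0 : 0 < ε' := by rw [hε'def]; positivity
  have hε'1 : ε' ≤ 1 := by
    rw [hε'def, div_le_one (by positivity)]; linarith
  have hε'a : 8 * (a + 1) * ε' = β / 2 := by rw [hε'def]; field_simp; norm_num
  obtain ⟨p, hp⟩ : ∃ p : ℕ, (1 / 2 : ℝ) ^ p < ε' / 2 :=
    exists_pow_lt_of_lt_one (by positivity) (by norm_num)
  obtain ⟨ε, hεdef⟩ : ∃ e : ℝ, e = ε' / 4 := ⟨_, rfl⟩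
  have hε0 : 0 < ε := by rw [hεdef]; positivity
  have hε1 : ε ≤ 1 := by rw [hεdef]; linarith
  have hR1 : 1 < 32 / ε := by rw [lt_div_iff₀ hε0]; linarith
  obtain ⟨r, hrdef⟩ : ∃ r : ℝ, r = Real.log (32 / ε) := ⟨_, rfl⟩
  have hr0 : 0 < r := by rw [hrdef]; exact Real.log_pos hR1
  obtain ⟨b, hbdef⟩ : ∃ b : ℝ, b = 1 / (8 * (p + 1) * r) := ⟨_, rfl⟩
  have hb0 : 0 < b := by rw [hbdef]; positivity
  have hbr : b * (2 * (p + 1) * r) = 1 / 4 := by rw [hbdef]; field_simp; norm_num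
  refine ⟨b, hb0, ?_⟩
  -- largeness
  have hev : ∀ᶠ y : ℝ in Filter.atTop,
      (1 ≤ y ∧ 2 / β ≤ y ∧ 4 ≤ y) ∧ Real.exp (y / 4) < Real.exp (y / 2) / 4 - (a + 1) * y := by
    refine ((Filter.eventually_ge_atTop 1).and ((Filter.eventually_ge_atTop _).and
      (Filter.eventually_ge_atTop _))).and ?_
    have h1 : Filter.Tendsto (fun y : ℝ => Real.exp (y / 4)) Filter.atTop Filter.atTop :=
      Real.tendsto_exp_atTop.comp (Filter.tendsto_id.atTop_div_const (by norm_num))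
    filter_upwards [h1.eventually_ge_atTop (4 * (2 + 4 * (a + 1))), Filter.eventually_ge_atTop 0]
      with y hy hy0
    have h2 : Real.exp (y / 2) = Real.exp (y / 4) * Real.exp (y / 4) := by
      rw [← Real.exp_add]; ring_nf
    have h3 : y / 4 + 1 ≤ Real.exp (y / 4) := Real.add_one_le_exp _
    have h4 : (a + 1) * y ≤ 4 * (a + 1) * Real.exp (y / 4) := by nlinarith
    have h5 : 0 < Real.exp (y / 4) := Real.exp_pos _
    rw [h2]
    nlinarith
  have hev2 : ∀ᶠ n : ℕ in Filter.atTop, (1 ≤ n) ∧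
      ((1 ≤ Real.log n ∧ 2 / β ≤ Real.log n ∧ 4 ≤ Real.log n) ∧
      Real.exp (Real.log n / 4) < Real.exp (Real.log n / 2) / 4 - (a + 1) * Real.log n) :=
    (Filter.eventually_ge_atTop 1).and
      ((Real.tendsto_log_atTop.comp tendsto_natCast_atTop_atTop).eventually hev)
  obtain ⟨N, hN⟩ := Filter.eventually_atTop.mp hev2
  refine ⟨N, ?_⟩
  intro V _ G hn hcl hind H
  obtain ⟨hn1, ⟨hy1, hyβ, hy4⟩, hyexp⟩ := hN _ hn
  have hn0 : (0 : ℝ) < Fintype.card V := by exact_mod_cast hn1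
  have hey : Real.exp (Real.log (Fintype.card V)) = Fintype.card V := Real.exp_log hn0
  generalize hy : Real.log (Fintype.card V) = y at *
  generalize hk : ⌊b * y⌋₊ = k at *
  by_contra hH
  have hkpos : 0 < k := by
    rcases Nat.eq_zero_or_pos k with rfl | h
    · exact absurd ⟨fun i => i.elim0, fun i => i.elim0, fun i => i.elim0⟩ hH
    · exact h
  have hkb : (k : ℝ) ≤ b * y := by rw [← hk]; exact Nat.floor_le (by positivity)
  obtain ⟨m, hmdef⟩ : ∃ m : ℕ, m = ⌈Real.exp (y / 2)⌉₊ := ⟨_, rfl⟩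
  have hm1 : Real.exp (y / 2) ≤ m := by rw [hmdef]; exact Nat.le_ceil _
  have hm2 : (m : ℝ) ≤ Real.exp (y / 2) + 1 := by
    rw [hmdef]; exact (Nat.ceil_lt_add_one (Real.exp_pos _).le).le
  have hm0 : 0 < m := by
    have : (0 : ℝ) < m := lt_of_lt_of_le (Real.exp_pos _) hm1
    exact_mod_cast this
  have hsize : (4 * (8 / ε) ^ k) ^ (p + p) * (m : ℝ) ≤ (Finset.univ : Finset V).card := by
    have h1 : 4 * (8 / ε) ^ k ≤ Real.exp (k * r) := by
      rw [Real.exp_nat_mul, hrdef, Real.exp_log (by positivity)]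
      have h32 : 32 / ε = 4 * (8 / ε) := by ring
      rw [h32, mul_pow]
      gcongr
      exact le_self_pow₀ (by norm_num) hkpos.ne'
    have h2 : (4 * (8 / ε) ^ k) ^ (p + p) ≤ Real.exp (y / 4) := by
      calc (4 * (8 / ε) ^ k) ^ (p + p) ≤ Real.exp (k * r) ^ (p + p) := by gcongr
        _ = Real.exp ((p + p : ℕ) * (k * r)) := (Real.exp_nat_mul _ _).symm
        _ ≤ Real.exp (y / 4) := by
          apply Real.exp_le_exp.mpr
          push_cast
          calc ((p : ℝ) + p) * (k * r) ≤ (2 * (p + 1)) * ((b * y) * r) := by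
                gcongr
                linarith
            _ = (b * (2 * (p + 1) * r)) * y := by ring
            _ = y / 4 := by rw [hbr]; ring
    have h3 : (m : ℝ) ≤ 2 * Real.exp (y / 2) := by
      have : 1 ≤ Real.exp (y / 2) := Real.one_le_exp (by linarith)
      linarith
    have h4 : 2 ≤ Real.exp (y / 4) := by
      have := Real.add_one_le_exp (y / 4); linarith
    rw [Finset.card_univ, ← hey]
    calc (4 * (8 / ε) ^ k) ^ (p + p) * (m : ℝ)
        ≤ Real.exp (y / 4) * (Real.exp (y / 4) * Real.exp (y / 2)) := by
          gcongr
          refine h3.trans ?_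
          gcongr
      _ = Real.exp y := by rw [← Real.exp_add, ← Real.exp_add]; ring_nf
  obtain ⟨X, -, hX⟩ := pr_claim G ε hε0 hε1 k hkpos H hH m hm0 (p + p) p p rfl Finset.univ hsize
  obtain ⟨s, hsdef⟩ : ∃ s : ℕ, s = ⌊β * y⌋₊ := ⟨_, rfl⟩
  obtain ⟨t, htdef⟩ : ∃ t : ℕ, t = ⌈a * y⌉₊ := ⟨_, rfl⟩
  have hβy : 2 ≤ β * y := by
    rw [div_le_iff₀ hβ0] at hyβ; linarith
  have hs1 : (s : ℝ) ≤ β * y := by rw [hsdef]; exact Nat.floor_le (by positivity)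
  have hs2 : β * y / 2 ≤ s := by
    have := Nat.lt_floor_add_one (β * y)
    rw [← hsdef] at this
    linarith
  have hs0 : 0 < s := by
    have : (0 : ℝ) < s := by linarith
    exact_mod_cast this
  have ht1 : (t : ℝ) ≤ (a + 1) * y := by
    have := Nat.ceil_lt_add_one (show 0 ≤ a * y by positivity)
    rw [← htdef] at this
    linarith
  have hst : 8 * (t : ℝ) * ε' ≤ s := by
    calc 8 * (t : ℝ) * ε' ≤ 8 * ((a + 1) * y) * ε' := by gcongr
      _ = (8 * (a + 1) * ε') * y := by ring
      _ = β * y / 2 := by rw [hε'a]; ring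
      _ ≤ s := hs2
  have hcl' : ∀ I : Finset V, G.IsClique (I : Set V) → I.card < t := fun I hI => by
    rw [htdef]; exact Nat.lt_ceil.mpr (hcl I hI)
  have hind' : ∀ I : Finset V, Gᶜ.IsClique (I : Set V) → I.card < t := fun I hI => by
    rw [htdef]; exact Nat.lt_ceil.mpr (hind I hI)
  have hbig : ∀ X : Finset V, X.card = 2 ^ p * m →
      (1 + x) ^ (s + 2 * t) < x ^ (2 * s) * ((X.card : ℝ) / 4 - t) := by
    intro X hX
    have h1 : (1 + x) ^ (s + 2 * t) ≤ Real.exp (y / 8) := by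
      calc (1 + x) ^ (s + 2 * t) ≤ Real.exp x ^ (s + 2 * t) := by
            gcongr
            have := Real.add_one_le_exp x
            linarith
        _ = Real.exp ((s + 2 * t : ℕ) * x) := (Real.exp_nat_mul _ _).symm
        _ ≤ Real.exp (y / 8) := by
          apply Real.exp_le_exp.mpr
          push_cast
          have h2 : (s : ℝ) + 2 * t ≤ 3 * (a + 1) * y := by
            have h5 : β * y ≤ 1 * y := by gcongr
            have h6 : 1 * y ≤ (a + 1) * y := by gcongr; linarith
            linarith
          calc ((s : ℝ) + 2 * t) * x ≤ 3 * (a + 1) * y * x := by gcongr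
            _ = (x * (3 * (a + 1))) * y := by ring
            _ = y / 8 := by rw [hxa]; ring
    have h2 : Real.exp (-(y / 8)) ≤ x ^ (2 * s) := by
      have : x ^ (2 * s) = Real.exp ((2 * s : ℕ) * (-l)) := by rw [Real.exp_nat_mul, ← hxl]
      rw [this]
      apply Real.exp_le_exp.mpr
      push_cast
      have : 2 * (s : ℝ) * l ≤ 2 * (β * y) * l := by gcongr
      have h3 : 2 * (β * y) * l = (2 * β * l) * y := by ring
      rw [hβl] at h3
      linarith
    have h3 : Real.exp (y / 4) < (X.card : ℝ) / 4 - t := by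
      have h4 : Real.exp (y / 2) ≤ X.card := by
        rw [hX]; push_cast
        have : (1 : ℝ) ≤ 2 ^ p := one_le_pow₀ (by norm_num)
        have h0 : (0 : ℝ) ≤ m := by positivity
        exact hm1.trans (le_mul_of_one_le_left h0 this)
      linarith
    calc (1 + x) ^ (s + 2 * t) ≤ Real.exp (y / 8) := h1
      _ = Real.exp (-(y / 8)) * Real.exp (y / 4) := by rw [← Real.exp_add]; ring_nf
      _ < Real.exp (-(y / 8)) * ((X.card : ℝ) / 4 - t) := by
        gcongr
      _ ≤ x ^ (2 * s) * ((X.card : ℝ) / 4 - t) := by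
        gcongr
        have := Real.exp_pos (y / 4)
        linarith
  have hdens : ∀ N : ℝ, ((1 / 2) ^ p + 2 * ε) * N ^ 2 ≤ ε' * N ^ 2 := by
    intro N
    gcongr
    rw [hεdef]; linarith
  rcases hX with ⟨hXc, hXs⟩ | ⟨hXc, hXs⟩
  · exact pr_es G X s t ε' x hε'0 hs0 hx0 (by linarith) (by rw [hXc]; positivity)
      (hXs.trans (hdens _)) hst hind' hcl' (hbig X hXc)
  · exact pr_es Gᶜ X s t ε' x hε'0 hs0 hx0 (by linarith) (by rw [hXc]; positivity)
      (hXs.trans (hdens _)) hst (by rw [compl_compl]; exact hcl') hind' (hbig X hXc)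
end

section
/- (Fox) There is a universal constant c > 0 such that for every sufficiently large integer k there exist ε > 0 and N ∈ ℕ with the following property: every finite simple graph G on n ≥ N vertices satisfying p(K_k, G) ≤ 2^{−binom(k,2)} + ε and p(K̄_k, G) ≤ 2^{−binom(k,2)} + ε contains every graph on ⌊ck⌋ vertices as an induced subgraph. -/
open Finset

-- the probability that a uniformly random `k`-element vertex subset of `G` induces a
-- complete graph
open Classical in
noncomputable def cliqueDensity {V : Type} [Fintype V] (k : ℕ) (G : SimpleGraph V) : ℝ :=
  ((((univ : Finset V).powersetCard k).filter (fun s => G.IsClique (s : Set V))).card : ℝ) /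
    ((Fintype.card V).choose k)


open Classical in
theorem fox_ramsey {V : Type} (G : SimpleGraph V) (p q : ℝ) (hp : 0 < p) (hq : 0 < q)
    (hpq : p + q = 1) : ∀ n a b : ℕ, a + b = n → ∀ S : Finset V,
    2 * ((p⁻¹) ^ a * (q⁻¹) ^ b) - 1 ≤ (S.card : ℝ) →
    (∃ C ⊆ S, G.IsClique (C : Set V) ∧ C.card = a) ∨
    (∃ I ⊆ S, Gᶜ.IsClique (I : Set V) ∧ I.card = b) := by
  intro n
  induction n with
  | zero =>
    intro a b hab S _
    left
    exact ⟨∅, by simp, by simp, by simp; omega⟩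
  | succ n ih =>
    intro a b hab S hS
    rcases a with _ | a
    · left; exact ⟨∅, by simp, by simp, by simp⟩
    rcases b with _ | b
    · right; exact ⟨∅, by simp, by simp, by simp⟩
    have hp1 : 1 ≤ p⁻¹ := (one_le_inv₀ hp).2 (by linarith)
    have hq1 : 1 ≤ q⁻¹ := (one_le_inv₀ hq).2 (by linarith)
    have hf : 1 ≤ (p⁻¹) ^ (a+1) * (q⁻¹) ^ (b+1) :=
      one_le_mul_of_one_le_of_one_le (one_le_pow₀ hp1) (one_le_pow₀ hq1)
    have hpos : 0 < S.card := by
      have : (0:ℝ) < S.card := by linarith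
      exact_mod_cast this
    obtain ⟨v, hv⟩ := Finset.card_pos.1 hpos
    set N := S.filter (fun w => G.Adj v w) with hN
    set M := S.filter (fun w => Gᶜ.Adj v w) with hM
    have hcard : S.card = N.card + M.card + 1 := by
      have h1 : S = insert v (N ∪ M) := by
        ext w
        simp only [hN, hM, Finset.mem_insert, Finset.mem_union, Finset.mem_filter,
          SimpleGraph.compl_adj]
        constructor
        · intro hw
          by_cases h : w = v
          · exact Or.inl h
          · by_cases h' : G.Adj v w
            · exact Or.inr (Or.inl ⟨hw, h'⟩)
            · exact Or.inr (Or.inr ⟨hw, fun e => h e.symm, h'⟩)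
        · rintro (h | h | h)
          · exact h ▸ hv
          · exact h.1
          · exact h.1
      have h2 : v ∉ N ∪ M := by simp [hN, hM]
      have h3 : Disjoint N M := by
        rw [Finset.disjoint_left]
        intro w hw hw'
        simp only [hN, hM, Finset.mem_filter, SimpleGraph.compl_adj] at hw hw'
        exact hw'.2.2 hw.2
      conv_lhs => rw [h1]
      rw [Finset.card_insert_of_notMem h2, Finset.card_union_of_disjoint h3]
    have hrec : (p⁻¹) ^ (a+1) * (q⁻¹) ^ (b+1) =
        (p⁻¹) ^ a * (q⁻¹) ^ (b+1) + (p⁻¹) ^ (a+1) * (q⁻¹) ^ b := by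
      have : p⁻¹ * q⁻¹ = p⁻¹ + q⁻¹ := by
        field_simp
        linarith
      calc (p⁻¹) ^ (a+1) * (q⁻¹) ^ (b+1) = (p⁻¹)^a * (q⁻¹)^b * (p⁻¹ * q⁻¹) := by ring
        _ = _ := by rw [this]; ring
    have hc : (S.card : ℝ) = N.card + M.card + 1 := by exact_mod_cast hcard
    by_cases hcase : 2 * ((p⁻¹) ^ a * (q⁻¹) ^ (b+1)) - 1 ≤ (N.card : ℝ)
    · rcases ih a (b+1) (by omega) N hcase with ⟨C, hC, hcl, hcc⟩ | ⟨I, hI, hcl, hcc⟩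
      · left
        refine ⟨insert v C, ?_, ?_, ?_⟩
        · intro w hw
          rcases Finset.mem_insert.1 hw with h | h
          · exact h ▸ hv
          · exact (Finset.mem_filter.1 (hC h)).1
        · rw [Finset.coe_insert]
          exact hcl.insert (fun w hw _ => (Finset.mem_filter.1 (hC hw)).2)
        · rw [Finset.card_insert_of_notMem, hcc]
          intro h
          exact G.irrefl (Finset.mem_filter.1 (hC h)).2
      · right
        exact ⟨I, hI.trans (Finset.filter_subset _ _), hcl, hcc⟩
    · have hcase' : 2 * ((p⁻¹) ^ (a+1) * (q⁻¹) ^ b) - 1 ≤ (M.card : ℝ) := by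
        rw [hrec] at hS; linarith
      rcases ih (a+1) b (by omega) M hcase' with ⟨C, hC, hcl, hcc⟩ | ⟨I, hI, hcl, hcc⟩
      · left
        exact ⟨C, hC.trans (Finset.filter_subset _ _), hcl, hcc⟩
      · right
        refine ⟨insert v I, ?_, ?_, ?_⟩
        · intro w hw
          rcases Finset.mem_insert.1 hw with h | h
          · exact h ▸ hv
          · exact (Finset.mem_filter.1 (hI h)).1
        · rw [Finset.coe_insert]
          exact hcl.insert (fun w hw _ => (Finset.mem_filter.1 (hI hw)).2)
        · rw [Finset.card_insert_of_notMem, hcc]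
          intro h
          exact Gᶜ.irrefl (Finset.mem_filter.1 (hI h)).2

open Classical in
/-- `A`, `B` are disjoint, large, and every vertex of `A` has few neighbours in `B`. -/
def FoxSparse {V : Type} (G : SimpleGraph V) (ε L : ℝ) (A B : Finset V) : Prop :=
  Disjoint A B ∧ L ≤ (A.card : ℝ) ∧ L ≤ (B.card : ℝ) ∧
    ∀ v ∈ A, ((B.filter (fun w => G.Adj v w)).card : ℝ) ≤ ε * B.card

open Classical in
theorem fox_embed {V : Type} (G : SimpleGraph V) (ε L : ℝ) (hε : 0 < ε) (hε1 : ε ≤ 1)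
    (hL : 0 < L) (S : Finset V) (h : ℕ)
    (hno : ∀ A ⊆ S, ∀ B ⊆ S, ¬ FoxSparse G ε L A B ∧ ¬ FoxSparse Gᶜ ε L A B) :
    ∀ m ≤ h, ∀ H : SimpleGraph (Fin m), ∀ U : Fin m → Finset V,
      (∀ i j, i ≠ j → Disjoint (U i) (U j)) → (∀ i, U i ⊆ S) →
      (∀ i, h * L * (ε⁻¹) ^ m ≤ ((U i).card : ℝ)) →
      ∃ f : Fin m → V, (∀ i, f i ∈ U i) ∧
        ∀ i j, i ≠ j → (H.Adj i j ↔ G.Adj (f i) (f j)) := by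
  intro m
  have hi1 : 1 ≤ ε⁻¹ := (one_le_inv₀ hε).2 hε1
  induction m with
  | zero =>
    intro _ H U _ _ _
    exact ⟨fun i => i.elim0, fun i => i.elim0, fun i => i.elim0⟩
  | succ m ih =>
    intro hm H U hd hS hU
    have hh : (m : ℝ) + 1 ≤ h := by exact_mod_cast hm
    have hpw : 1 ≤ (ε⁻¹) ^ (m+1) := one_le_pow₀ hi1
    have hhL : 0 < (h:ℝ) * L := mul_pos (by linarith [(Nat.cast_nonneg m : (0:ℝ) ≤ m)]) hL
    have hUL : ∀ i, h * L ≤ ((U i).card : ℝ) := fun i =>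
      (le_mul_of_one_le_right hhL.le hpw).trans (hU i)
    have hLh : L ≤ h * L := by nlinarith [(Nat.cast_nonneg m : (0:ℝ) ≤ m)]
    let K : Fin m → SimpleGraph V := fun j => if H.Adj 0 j.succ then G else Gᶜ
    let bad : Fin m → Finset V := fun j => (U 0).filter
      (fun v => (((U j.succ).filter (fun w => (K j).Adj v w)).card : ℝ) ≤ ε * (U j.succ).card)
    have hbad : ∀ j, ((bad j).card : ℝ) < L := by
      intro j
      by_contra hcon
      push Not at hcon
      have hsp : FoxSparse (K j) ε L (bad j) (U j.succ) := by
        refine ⟨?_, hcon, hLh.trans (hUL _), ?_⟩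
        · exact Finset.disjoint_of_subset_left (Finset.filter_subset _ _)
            (hd 0 j.succ (Fin.succ_ne_zero j).symm)
        · intro v hv
          exact (Finset.mem_filter.1 hv).2
      have hn := hno (bad j) ((Finset.filter_subset _ _).trans (hS 0)) (U j.succ) (hS _)
      by_cases hH : H.Adj 0 j.succ
      · simp only [K, hH, if_true] at hsp; exact hn.1 hsp
      · simp only [K, hH, if_false] at hsp; exact hn.2 hsp
    have hex : ∃ v ∈ U 0, v ∉ Finset.univ.biUnion bad := by
      by_contra hcon
      push Not at hcon
      have h1 : (U 0).card ≤ (Finset.univ.biUnion bad).card := Finset.card_le_card hcon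
      have h2 : (Finset.univ.biUnion bad).card ≤ ∑ j, (bad j).card := Finset.card_biUnion_le
      have h3 : (∑ j, ((bad j).card : ℝ)) ≤ ∑ j : Fin m, L :=
        Finset.sum_le_sum (fun j _ => (hbad j).le)
      rw [Finset.sum_const, Finset.card_univ, Fintype.card_fin, nsmul_eq_mul] at h3
      have h4 : ((U 0).card : ℝ) ≤ ∑ j, ((bad j).card : ℝ) := by exact_mod_cast h1.trans h2
      have := hUL 0
      nlinarith
    obtain ⟨v, hv0, hv⟩ := hex
    have hgood : ∀ j, ε * (U j.succ).card ≤
        (((U j.succ).filter (fun w => (K j).Adj v w)).card : ℝ) := by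
      intro j
      by_contra hcon
      push Not at hcon
      exact hv (Finset.mem_biUnion.2 ⟨j, Finset.mem_univ _, Finset.mem_filter.2 ⟨hv0, hcon.le⟩⟩)
    obtain ⟨f, hf, hfa⟩ := ih (by omega) (H.comap Fin.succ)
      (fun j => (U j.succ).filter (fun w => (K j).Adj v w))
      (fun i j hij => Finset.disjoint_of_subset_left (Finset.filter_subset _ _)
        (Finset.disjoint_of_subset_right (Finset.filter_subset _ _)
          (hd _ _ (fun e => hij (Fin.succ_injective _ e)))))
      (fun i => (Finset.filter_subset _ _).trans (hS _))
      (fun j => by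
        refine le_trans ?_ (hgood j)
        have := mul_le_mul_of_nonneg_left (hU j.succ) hε.le
        refine le_trans (le_of_eq ?_) this
        rw [pow_succ]
        field_simp)
    have hvf : ∀ j, H.Adj 0 j.succ ↔ G.Adj v (f j) := by
      intro j
      have hj := (Finset.mem_filter.1 (hf j)).2
      by_cases hH : H.Adj 0 j.succ
      · simp only [K, hH, if_true] at hj; simp [hH, hj]
      · simp only [K, hH, if_false, SimpleGraph.compl_adj] at hj; simp [hH, hj.2]
    refine ⟨Fin.cons v f, ?_, ?_⟩
    · intro i
      refine Fin.cases ?_ (fun j => ?_) i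
      · simpa using hv0
      · simpa using (Finset.mem_filter.1 (hf j)).1
    · intro i j
      refine Fin.cases ?_ (fun i => ?_) i
      · refine Fin.cases ?_ (fun j => ?_) j
        · intro h; exact absurd rfl h
        · intro _; simpa using hvf j
      · refine Fin.cases ?_ (fun j => ?_) j
        · intro _
          rw [SimpleGraph.adj_comm, G.adj_comm]; simpa using hvf i
        · intro hij
          have := hfa i j (fun e => hij (by rw [e]))
          simpa using this

open Classical in
/-- Every large set in a graph with no induced `H` contains a sparse or a dense pair. -/
theorem fox_pair {V : Type} (G : SimpleGraph V) (ε : ℝ) (hε : 0 < ε) (hε1 : ε ≤ 1)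
    (h : ℕ) (hh : 1 ≤ h) (H : SimpleGraph (Fin h))
    (hH : ¬ ∃ f : Fin h → V, Function.Injective f ∧ ∀ i j, H.Adj i j ↔ G.Adj (f i) (f j))
    (S : Finset V) (hS : 2 * h ≤ S.card) (L : ℝ) (hL : 0 < L)
    (hLS : 2 * h ^ 2 * (ε⁻¹) ^ h * L ≤ (S.card : ℝ)) :
    ∃ A ⊆ S, ∃ B ⊆ S, FoxSparse G ε L A B ∨ FoxSparse Gᶜ ε L A B := by
  by_contra hcon
  push Not at hcon
  apply hH
  obtain ⟨q, hq⟩ : ∃ q, q = S.card / h := ⟨_, rfl⟩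
  have hqS : h * q ≤ S.card := by rw [hq]; exact Nat.mul_div_le _ _
  have hcard : Fintype.card (Fin h × Fin q) ≤ Fintype.card S := by simpa using hqS
  obtain ⟨e⟩ := Function.Embedding.nonempty_of_card_le hcard
  let U : Fin h → Finset V := fun i => Finset.univ.image (fun j : Fin q => (e (i, j) : V))
  have hUc : ∀ i, (U i).card = q := by
    intro i
    rw [Finset.card_image_of_injective]
    · simp
    · intro a b hab
      have := e.injective (Subtype.ext hab)
      simpa using this
  have hUd : ∀ i j, i ≠ j → Disjoint (U i) (U j) := by
    intro i j hij
    rw [Finset.disjoint_left]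
    intro w hw hw'
    obtain ⟨a, _, ha⟩ := Finset.mem_image.1 hw
    obtain ⟨b, _, hb⟩ := Finset.mem_image.1 hw'
    have := e.injective (Subtype.ext (ha.trans hb.symm))
    simp only [Prod.mk.injEq] at this
    exact hij this.1
  have hhr : (1:ℝ) ≤ h := by exact_mod_cast hh
  have hq2 : (S.card : ℝ) ≤ 2 * h * q := by
    have h1 : S.card < h * q + h := by
      rw [hq]; have := Nat.lt_mul_div_succ S.card (show 0 < h by omega)
      rw [mul_add, mul_one] at this; exact this
    have h2 : S.card ≤ 2 * h * q := by
      have : 2 * S.card + 1 ≤ 2 * (h * q) + S.card := by omega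
      nlinarith
    exact_mod_cast h2
  obtain ⟨f, hf, hfa⟩ := fox_embed G ε L hε hε1 hL S h hcon h le_rfl H U hUd
    (fun i w hw => by
      obtain ⟨a, _, ha⟩ := Finset.mem_image.1 hw
      rw [← ha]; exact (e (i, a)).2)
    (fun i => by
      rw [hUc]
      have h3 : (2 * h) * (h * L * (ε⁻¹) ^ h) ≤ (2 * h) * (q : ℝ) := by
        refine le_trans (le_of_eq ?_) (hLS.trans hq2); ring
      exact le_of_mul_le_mul_left h3 (by linarith))
  have hinj : Function.Injective f := by
    intro i j hij
    by_contra hne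
    exact (Finset.disjoint_left.1 (hUd i j hne)) (hf i) (hij ▸ hf j)
  refine ⟨f, hinj, ?_⟩
  intro i j
  by_cases hij : i = j
  · subst hij; simp
  · exact hfa i j hij

open Classical in
/-- Weighted pigeonhole: many vertices of `B` have the same neighbourhood `N` in `I`. -/
theorem fox_pigeon {V : Type} (G : SimpleGraph V) (x : ℝ) (I B : Finset V) :
    ∃ N ⊆ I, x ^ N.card * (B.card : ℝ) ≤
      ((B.filter (fun v => I.filter (fun w => G.Adj w v) = N)).card : ℝ) * (1 + x) ^ I.card := by
  have h1 : B.card = ∑ N ∈ I.powerset,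
      (B.filter (fun v => I.filter (fun w => G.Adj w v) = N)).card :=
    Finset.card_eq_sum_card_fiberwise (fun v _ => by
      simp only [Finset.coe_powerset, Set.mem_preimage, Set.mem_powerset_iff]
      exact_mod_cast Finset.filter_subset _ _)
  have h2 : ∑ N ∈ I.powerset, x ^ N.card = (1 + x) ^ I.card := by
    have := Finset.sum_pow_mul_eq_add_pow x 1 I
    simp only [one_pow, mul_one] at this
    rw [this, add_comm]
  have h3 : ∑ N ∈ I.powerset, x ^ N.card * (B.card : ℝ) ≤ ∑ N ∈ I.powerset,
      ((B.filter (fun v => I.filter (fun w => G.Adj w v) = N)).card : ℝ) * (1 + x) ^ I.card := by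
    rw [← Finset.sum_mul, ← Finset.sum_mul, h2, mul_comm]
    have : (B.card : ℝ) = ∑ N ∈ I.powerset,
      ((B.filter (fun v => I.filter (fun w => G.Adj w v) = N)).card : ℝ) := by exact_mod_cast h1
    rw [← this]
  obtain ⟨N, hN, hle⟩ := Finset.exists_le_of_sum_le (Finset.powerset_nonempty I) h3
  exact ⟨N, Finset.mem_powerset.1 hN, hle⟩

open Classical in
theorem fox_half {V : Type} (G : SimpleGraph V) (ε : ℝ) (hε : 0 < ε) (I B : Finset V)
    (hI : 0 < I.card)
    (hs : ∀ v ∈ I, ((B.filter (fun w => G.Adj v w)).card : ℝ) ≤ ε * B.card) :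
    (B.card : ℝ) ≤ 2 * (B.filter (fun v =>
      ((I.filter (fun w => G.Adj w v)).card : ℝ) ≤ 2 * ε * I.card)).card := by
  have hdc : ∑ v ∈ I, (B.filter (fun w => G.Adj v w)).card
      = ∑ w ∈ B, (I.filter (fun v => G.Adj v w)).card :=
    Finset.sum_card_bipartiteAbove_eq_sum_card_bipartiteBelow (fun v w => G.Adj v w)
  have hdcr : ∑ v ∈ I, ((B.filter (fun w => G.Adj v w)).card : ℝ)
      = ∑ w ∈ B, ((I.filter (fun v => G.Adj v w)).card : ℝ) := by exact_mod_cast hdc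
  have hup : ∑ v ∈ I, ((B.filter (fun w => G.Adj v w)).card : ℝ) ≤ I.card * (ε * B.card) := by
    refine (Finset.sum_le_sum hs).trans ?_
    simp
  set P : V → Prop := fun v => ((I.filter (fun w => G.Adj w v)).card : ℝ) ≤ 2 * ε * I.card
  have hlow : ((B.filter (fun v => ¬ P v)).card : ℝ) * (2 * ε * I.card) ≤
      ∑ w ∈ B, ((I.filter (fun v => G.Adj v w)).card : ℝ) := by
    refine le_trans ?_ (Finset.sum_le_sum_of_subset_of_nonneg
      (Finset.filter_subset (fun v => ¬ P v) B) (fun _ _ _ => by positivity))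
    rw [← nsmul_eq_mul]
    refine Finset.card_nsmul_le_sum _ _ _ (fun v hv => ?_)
    have := (Finset.mem_filter.1 hv).2
    simp only [P] at this
    push Not at this
    exact this.le
  have hsum : (B.filter P).card + (B.filter (fun v => ¬ P v)).card = B.card :=
    Finset.card_filter_add_card_filter_not P
  have hsumr : ((B.filter P).card : ℝ) + (B.filter (fun v => ¬ P v)).card = B.card := by
    exact_mod_cast hsum
  have hIr : (0:ℝ) < I.card := by exact_mod_cast hI
  have h4 : (ε * I.card) * (2 * ((B.filter (fun v => ¬ P v)).card : ℝ)) ≤ (ε * I.card) * B.card := by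
    rw [hdcr] at hup
    linarith
  have := le_of_mul_le_mul_left h4 (by positivity)
  linarith

open Classical in
theorem fox_step {V : Type} (G : SimpleGraph V) (ε x n P L : ℝ) (k m : ℕ) (hε : 0 < ε)
    (hε1 : ε ≤ 1 / 4) (hx : 0 < x) (hx1 : x ≤ 1) (hn : 0 < n) (hP : 0 < P)
    (hm : 2 * ε * k ≤ m)
    (hI : ∀ I : Finset V, Gᶜ.IsClique (I : Set V) → I.card ≤ k)
    (hQ : ∀ S : Finset V, n ≤ (S.card : ℝ) → ∃ C ⊆ S, ∃ I ⊆ S, G.IsClique (C : Set V) ∧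
      Gᶜ.IsClique (I : Set V) ∧ P ≤ (C.card : ℝ) * I.card)
    (hL : 2 * (1 + x) ^ k * (x⁻¹) ^ m * n ≤ L)
    (A B : Finset V) (hAB : FoxSparse G ε L A B) :
    ∃ C ⊆ A ∪ B, ∃ I ⊆ A ∪ B, G.IsClique (C : Set V) ∧
      Gᶜ.IsClique (I : Set V) ∧ 3 / 2 * P ≤ (C.card : ℝ) * I.card := by
  obtain ⟨hd, hA, hB, hs⟩ := hAB
  have h1 : (1:ℝ) ≤ (1 + x) ^ k := one_le_pow₀ (by linarith)
  have h2 : (1:ℝ) ≤ (x⁻¹) ^ m := one_le_pow₀ ((one_le_inv₀ hx).2 hx1)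
  have hLn : n ≤ L := by
    have : 1 ≤ (1 + x) ^ k * (x⁻¹) ^ m := one_le_mul_of_one_le_of_one_le h1 h2
    nlinarith
  obtain ⟨C₁, hC₁, I₁, hI₁, hCc₁, hIc₁, hP₁⟩ := hQ A (hLn.trans hA)
  have hI₁0 : 0 < I₁.card := by
    rcases Nat.eq_zero_or_pos I₁.card with h | h
    · rw [h] at hP₁; simp at hP₁; linarith
    · exact h
  have hhalf := fox_half G ε hε I₁ B hI₁0 (fun v hv => hs v (hI₁ hv))
  set B' := B.filter (fun v =>
      ((I₁.filter (fun w => G.Adj w v)).card : ℝ) ≤ 2 * ε * I₁.card) with hB'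
  obtain ⟨N, hN, hNle⟩ := fox_pigeon G x I₁ B'
  set B'' := B'.filter (fun v => I₁.filter (fun w => G.Adj w v) = N) with hB''
  have hB'0 : (0:ℝ) < B'.card := by linarith
  have hIk : I₁.card ≤ k := hI I₁ hIc₁
  have hB''0 : 0 < B''.card := by
    rcases Nat.eq_zero_or_pos B''.card with h | h
    · rw [h] at hNle
      have : 0 < x ^ N.card * (B'.card : ℝ) := by positivity
      simp at hNle
      linarith
    · exact h
  have hNc : (N.card : ℝ) ≤ 2 * ε * I₁.card := by
    obtain ⟨v, hv⟩ := Finset.card_pos.1 hB''0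
    have hv1 := Finset.mem_filter.1 hv
    have hv2 := (Finset.mem_filter.1 hv1.1).2
    rw [hv1.2] at hv2
    exact hv2
  have hNm : N.card ≤ m := by
    have : (I₁.card : ℝ) ≤ k := by exact_mod_cast hIk
    have : (N.card : ℝ) ≤ m := by nlinarith
    exact_mod_cast this
  have hB''n : n ≤ (B''.card : ℝ) := by
    have e1 : x ^ m ≤ x ^ N.card := pow_le_pow_of_le_one hx.le hx1 hNm
    have e2 : (1 + x) ^ I₁.card ≤ (1 + x) ^ k := pow_le_pow_right₀ (by linarith) hIk
    have e3 : x ^ m * (B'.card : ℝ) ≤ B''.card * (1 + x) ^ k :=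
      (mul_le_mul_of_nonneg_right e1 hB'0.le).trans (hNle.trans
        (mul_le_mul_of_nonneg_left e2 (by positivity)))
    have e4 : (1 + x) ^ k * (x⁻¹) ^ m * n ≤ B'.card := by linarith
    have e5 : x ^ m * ((1 + x) ^ k * (x⁻¹) ^ m * n) ≤ x ^ m * B'.card :=
      mul_le_mul_of_nonneg_left e4 (by positivity)
    have e6 : x ^ m * ((1 + x) ^ k * (x⁻¹) ^ m * n) = n * (1 + x) ^ k := by
      rw [inv_pow]; field_simp
    rw [e6] at e5
    exact le_of_mul_le_mul_right (e5.trans e3) (by positivity)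
  obtain ⟨C₂, hC₂, I₂, hI₂, hCc₂, hIc₂, hP₂⟩ := hQ B'' hB''n
  have hB''B : B'' ⊆ B := (Finset.filter_subset _ _).trans (Finset.filter_subset _ _)
  have hdis : Disjoint (I₁ \ N) I₂ :=
    Finset.disjoint_of_subset_left (Finset.sdiff_subset.trans hI₁)
      (Finset.disjoint_of_subset_right (hI₂.trans hB''B) hd)
  have hIcl : Gᶜ.IsClique (((I₁ \ N) ∪ I₂ : Finset V) : Set V) := by
    have key : ∀ a ∈ I₁ \ N, ∀ b ∈ I₂, a ≠ b → Gᶜ.Adj a b := by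
      intro a ha b hb hab
      rw [SimpleGraph.compl_adj]
      refine ⟨hab, fun hadj => ?_⟩
      have hb2 := (Finset.mem_filter.1 (hI₂ hb)).2
      have ha' := Finset.mem_sdiff.1 ha
      apply ha'.2
      rw [← hb2]
      exact Finset.mem_filter.2 ⟨ha'.1, hadj⟩
    intro a ha b hb hab
    rw [Finset.mem_coe, Finset.mem_union] at ha hb
    rcases ha with ha | ha <;> rcases hb with hb | hb
    · exact hIc₁ (Finset.mem_sdiff.1 ha).1 (Finset.mem_sdiff.1 hb).1 hab
    · exact key a ha b hb hab
    · exact (key b hb a ha hab.symm).symm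
    · exact hIc₂ ha hb hab
  have hIsub : (I₁ \ N) ∪ I₂ ⊆ A ∪ B :=
    Finset.union_subset_union (Finset.sdiff_subset.trans hI₁) (hI₂.trans hB''B)
  have hIcard : (((I₁ \ N) ∪ I₂).card : ℝ) = I₁.card - N.card + I₂.card := by
    rw [Finset.card_union_of_disjoint hdis, Finset.card_sdiff_of_subset hN]
    push_cast [Finset.card_le_card hN]
    ring
  have hIge : (1/2 : ℝ) * I₁.card + I₂.card ≤ (((I₁ \ N) ∪ I₂).card : ℝ) := by
    rw [hIcard]
    nlinarith
  have fin : ∀ C : Finset V, C₁.card ≤ C.card → C₂.card ≤ C.card →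
      3 / 2 * P ≤ (C.card : ℝ) * ((I₁ \ N) ∪ I₂).card := by
    intro C ha hb
    have ha' : (C₁.card : ℝ) ≤ C.card := by exact_mod_cast ha
    have hb' : (C₂.card : ℝ) ≤ C.card := by exact_mod_cast hb
    have f1 := mul_le_mul_of_nonneg_right ha' (Nat.cast_nonneg (α := ℝ) I₁.card)
    have f2 := mul_le_mul_of_nonneg_right hb' (Nat.cast_nonneg (α := ℝ) I₂.card)
    have f3 := mul_le_mul_of_nonneg_left hIge (Nat.cast_nonneg (α := ℝ) C.card)
    linarith
  rcases le_total C₁.card C₂.card with h | h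
  · exact ⟨C₂, (hC₂.trans hB''B).trans Finset.subset_union_right, _, hIsub, hCc₂, hIcl,
      fin C₂ h le_rfl⟩
  · exact ⟨C₁, hC₁.trans Finset.subset_union_left, _, hIsub, hCc₁, hIcl,
      fin C₁ le_rfl h⟩

open Classical in
theorem fox_density_eq {V : Type} [Fintype V] (k : ℕ) (G : SimpleGraph V) :
    cliqueDensity k G = ((((Finset.univ : Finset V).powersetCard k).filter
      (fun s : Finset V => G.IsClique (s : Set V))).card : ℝ) /
        ((Fintype.card V).choose k : ℝ) := by
  unfold cliqueDensity
  congr 2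
  rw [← Finset.card_image_of_injective _ (Finset.coe_injective (α := V))]
  congr 1
  ext t
  simp only [Finset.bind_def, Finset.pure_def, Finset.mem_filter, Finset.mem_sup,
    Finset.mem_singleton, Finset.mem_image]
  constructor
  · rintro ⟨⟨s, hs, rfl⟩, h⟩
    exact ⟨s, ⟨hs, h⟩, rfl⟩
  · rintro ⟨s, ⟨hs, h⟩, rfl⟩
    exact ⟨⟨s, hs, rfl⟩, h⟩

theorem fox_arith (k h a m : ℕ) (hk : 20000 ≤ k) (hhk : 20000 * h ≤ k) (ha : a = k / 192)
    (hm : m = k / 8192 + 1) :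
    (16 * h + k / 512 + 10 * m + 3) * 30 + (k / 32 + 6 * a + 2) ≤ k / 4 := by
  subst ha hm
  have h1 : 512 * (k / 512) ≤ k := Nat.mul_div_le _ _
  have h2 : 8192 * (k / 8192) ≤ k := Nat.mul_div_le _ _
  have h3 : 32 * (k / 32) ≤ k := Nat.mul_div_le _ _
  have h4 : 192 * (k / 192) ≤ k := Nat.mul_div_le _ _
  rw [Nat.le_div_iff_mul_le (by norm_num)]
  generalize k / 512 = a at *
  generalize k / 8192 = b at *
  generalize k / 32 = c at *
  generalize k / 192 = d at *
  linarith

/-- Every set of at least `n` vertices has a clique and an independent set whose sizes have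
product at least `P`. -/
def FoxProd {V : Type} (G : SimpleGraph V) (n P : ℝ) : Prop :=
  ∀ S : Finset V, n ≤ (S.card : ℝ) → ∃ C ⊆ S, ∃ I ⊆ S, G.IsClique (C : Set V) ∧
      Gᶜ.IsClique (I : Set V) ∧ P ≤ (C.card : ℝ) * I.card

theorem FoxProd.compl {V : Type} {G : SimpleGraph V} {n P : ℝ} (hQ : FoxProd G n P) :
    FoxProd Gᶜ n P := by
  intro S hS
  obtain ⟨C, hC, I, hI, h1, h2, h3⟩ := hQ S hS
  exact ⟨I, hI, C, hC, h2, by rwa [compl_compl], by rwa [mul_comm]⟩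

theorem fox_level {V : Type} (G : SimpleGraph V) (ε x n P : ℝ) (k m h : ℕ) (hε : 0 < ε)
    (hε1 : ε ≤ 1 / 4) (hx : 0 < x) (hx1 : x ≤ 1) (hn : 1 ≤ n) (hP : 0 < P)
    (hm : 2 * ε * k ≤ m)
    (hC : ∀ I : Finset V, G.IsClique (I : Set V) → I.card ≤ k)
    (hI : ∀ I : Finset V, Gᶜ.IsClique (I : Set V) → I.card ≤ k)
    (hh : 1 ≤ h) (H : SimpleGraph (Fin h))
    (hH : ¬ ∃ f : Fin h → V, Function.Injective f ∧ ∀ i j, H.Adj i j ↔ G.Adj (f i) (f j))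
    (hQ : FoxProd G n P) :
    FoxProd G ((2 * h ^ 2 * (ε⁻¹) ^ h) * (2 * (1 + x) ^ k * (x⁻¹) ^ m) * n) (3 / 2 * P) := by
  classical
  intro S hS
  have hhr : (1:ℝ) ≤ h := by exact_mod_cast hh
  have h1 : (1:ℝ) ≤ (1 + x) ^ k := one_le_pow₀ (by linarith)
  have h2 : (1:ℝ) ≤ (x⁻¹) ^ m := one_le_pow₀ ((one_le_inv₀ hx).2 hx1)
  have h3 : (1:ℝ) ≤ (ε⁻¹) ^ h := one_le_pow₀ ((one_le_inv₀ hε).2 (by linarith))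
  set L := 2 * (1 + x) ^ k * (x⁻¹) ^ m * n with hLdef
  have hL1 : 1 ≤ L := by
    have : 1 ≤ (1 + x) ^ k * (x⁻¹) ^ m := one_le_mul_of_one_le_of_one_le h1 h2
    have := one_le_mul_of_one_le_of_one_le this hn
    rw [hLdef]; nlinarith
  have hSL : 2 * h ^ 2 * (ε⁻¹) ^ h * L ≤ (S.card : ℝ) := by
    refine le_trans (le_of_eq ?_) hS
    rw [hLdef]; ring
  have hS2 : 2 * h ≤ S.card := by
    have h4 : (1:ℝ) ≤ (ε⁻¹) ^ h * L := one_le_mul_of_one_le_of_one_le h3 hL1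
    have h5 : (2:ℝ) * h ≤ 2 * h ^ 2 * ((ε⁻¹) ^ h * L) := by
      have : (2:ℝ) * h ≤ 2 * h ^ 2 := by nlinarith
      exact this.trans (le_mul_of_one_le_right (by positivity) h4)
    have : (2:ℝ) * h ≤ S.card := by linarith
    exact_mod_cast this
  obtain ⟨A, hA, B, hB, hAB⟩ := fox_pair G ε hε (by linarith) h hh H hH S hS2 L
    (by linarith) hSL
  have hu : A ∪ B ⊆ S := Finset.union_subset hA hB
  rcases hAB with hAB | hAB
  · obtain ⟨C, hC', I, hI', a, b, c⟩ := fox_step G ε x n P L k m hε hε1 hx hx1 (by linarith) hP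
      hm hI hQ le_rfl A B hAB
    exact ⟨C, hC'.trans hu, I, hI'.trans hu, a, b, c⟩
  · obtain ⟨C, hC', I, hI', a, b, c⟩ := fox_step Gᶜ ε x n P L k m hε hε1 hx hx1 (by linarith) hP
      hm (by rwa [compl_compl]) hQ.compl le_rfl A B hAB
    rw [compl_compl] at b
    exact ⟨I, hI'.trans hu, C, hC'.trans hu, b, a, by rw [mul_comm (I.card : ℝ)]; exact c⟩

theorem fox_base {V : Type} (G : SimpleGraph V) (k a : ℕ)
    (hC : ∀ I : Finset V, G.IsClique (I : Set V) → I.card ≠ k)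
    (hI : ∀ I : Finset V, Gᶜ.IsClique (I : Set V) → I.card ≠ k) :
    FoxProd G (2 * ((64 / 63) ^ k * 64 ^ a)) ((a : ℝ) * a) := by
  intro S hS
  have hS' : 2 * (((63 / 64 : ℝ)⁻¹) ^ k * ((1 / 64 : ℝ)⁻¹) ^ a) - 1 ≤ (S.card : ℝ) := by
    have e1 : (63 / 64 : ℝ)⁻¹ = 64 / 63 := by norm_num
    have e2 : (1 / 64 : ℝ)⁻¹ = 64 := by norm_num
    rw [e1, e2]; linarith
  have r1 := fox_ramsey G (63 / 64) (1 / 64) (by norm_num) (by norm_num) (by norm_num)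
    (k + a) k a rfl S hS'
  have r2 := fox_ramsey Gᶜ (63 / 64) (1 / 64) (by norm_num) (by norm_num) (by norm_num)
    (k + a) k a rfl S hS'
  rw [compl_compl] at r2
  rcases r1 with ⟨C, _, h1, h2⟩ | ⟨I, hIS, h1, h2⟩
  · exact absurd h2 (hC C h1)
  rcases r2 with ⟨C, _, h3, h4⟩ | ⟨J, hJS, h3, h4⟩
  · exact absurd h4 (hI C h3)
  exact ⟨J, hJS, I, hIS, h3, h1, by rw [h2, h4]⟩

/-- A Prömel–Rödl type theorem. -/
theorem fox_promel_rodl {V : Type} [Fintype V] (G : SimpleGraph V) (k h : ℕ) (hk : 20000 ≤ k)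
    (hh : 1 ≤ h) (hhk : 20000 * h ≤ k) (hV : 2 ^ (k / 4) ≤ Fintype.card V)
    (hC : ∀ I : Finset V, G.IsClique (I : Set V) → I.card ≠ k)
    (hI : ∀ I : Finset V, Gᶜ.IsClique (I : Set V) → I.card ≠ k)
    (H : SimpleGraph (Fin h)) :
    ∃ f : Fin h → V, Function.Injective f ∧ ∀ i j, H.Adj i j ↔ G.Adj (f i) (f j) := by
  by_contra hH
  have small : ∀ G' : SimpleGraph V, (∀ I : Finset V, G'.IsClique (I : Set V) → I.card ≠ k) →
      ∀ I : Finset V, G'.IsClique (I : Set V) → I.card < k := by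
    intro G' hG' I hI
    by_contra hlt
    push Not at hlt
    obtain ⟨J, hJ, hJc⟩ := Finset.exists_subset_card_eq hlt
    exact hG' J (hI.subset (by exact_mod_cast hJ)) hJc
  have hC' := small G hC
  have hI' := small Gᶜ hI
  obtain ⟨a, ha⟩ : ∃ a, a = k / 192 := ⟨_, rfl⟩
  obtain ⟨m, hm⟩ : ∃ m, m = k / 8192 + 1 := ⟨_, rfl⟩
  have hka : k ≤ 384 * a := by omega
  have ha1 : 1 ≤ a := by omega
  have har : (1:ℝ) ≤ a := by exact_mod_cast ha1
  have hmk : 2 * (1 / 2 ^ 14 : ℝ) * k ≤ m := by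
    have : k ≤ 8192 * m := by omega
    have : (k:ℝ) ≤ 8192 * m := by exact_mod_cast this
    linarith
  set Q : ℝ := (2 * h ^ 2 * ((1 / 2 ^ 14 : ℝ)⁻¹) ^ h) *
    (2 * (1 + 1 / 1024 : ℝ) ^ k * ((1 / 1024 : ℝ)⁻¹) ^ m) with hQdef
  set n₀ : ℝ := 2 * ((64 / 63) ^ k * 64 ^ a) with hn₀
  have hn₀1 : 1 ≤ n₀ := by
    have := one_le_mul_of_one_le_of_one_le (one_le_pow₀ (n := k) (show (1:ℝ) ≤ 64/63 by norm_num))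
      (one_le_pow₀ (n := a) (show (1:ℝ) ≤ 64 by norm_num))
    rw [hn₀]; linarith
  have hhr : (1:ℝ) ≤ h := by exact_mod_cast hh
  have hQ1 : 1 ≤ Q := by
    have e1 : (1:ℝ) ≤ ((1 / 2 ^ 14 : ℝ)⁻¹) ^ h := one_le_pow₀ (by norm_num)
    have e2 : (1:ℝ) ≤ (1 + 1 / 1024 : ℝ) ^ k := one_le_pow₀ (by norm_num)
    have e3 : (1:ℝ) ≤ ((1 / 1024 : ℝ)⁻¹) ^ m := one_le_pow₀ (by norm_num)
    have e4 : (1:ℝ) ≤ 2 * h ^ 2 := by nlinarith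
    exact one_le_mul_of_one_le_of_one_le (one_le_mul_of_one_le_of_one_le e4 e1)
      (one_le_mul_of_one_le_of_one_le (by linarith) e3)
  have iter : ∀ t : ℕ, FoxProd G (Q ^ t * n₀) ((3 / 2) ^ t * ((a : ℝ) * a)) := by
    intro t
    induction t with
    | zero => simpa using fox_base G k a hC hI
    | succ t ih =>
      have := fox_level G (1 / 2 ^ 14) (1 / 1024) (Q ^ t * n₀) ((3 / 2) ^ t * ((a : ℝ) * a)) k m h
        (by norm_num) (by norm_num) (by norm_num) (by norm_num)
        (one_le_mul_of_one_le_of_one_le (one_le_pow₀ hQ1) hn₀1) (by positivity) hmk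
        (fun I hI => (hC' I hI).le) (fun I hI => (hI' I hI).le) hh H hH ih
      rw [← hQdef] at this
      convert this using 1 <;> ring
  -- numerical estimates
  have e1 : (h:ℝ) ^ 2 ≤ 2 ^ (2 * h) := by
    have : h ≤ 2 ^ h := Nat.lt_two_pow_self.le
    have : (h:ℝ) ≤ 2 ^ h := by exact_mod_cast this
    calc (h:ℝ) ^ 2 ≤ (2 ^ h) ^ 2 := by gcongr
      _ = 2 ^ (2 * h) := by rw [← pow_mul, mul_comm]
  have e2 : ((1 / 2 ^ 14 : ℝ)⁻¹) ^ h = 2 ^ (14 * h) := by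
    rw [one_div, inv_inv, ← pow_mul]
  have e3 : (1 + 1 / 1024 : ℝ) ^ k ≤ 2 ^ (k / 512 + 1) := by
    have hb : (1 + 1 / 1024 : ℝ) ^ 512 ≤ 2 := by
      have hb1 : (1 + 1 / 1024 : ℝ) ^ 16 ≤ 1016 / 1000 := by norm_num
      calc (1 + 1 / 1024 : ℝ) ^ 512 = ((1 + 1 / 1024 : ℝ) ^ 16) ^ 32 := by rw [← pow_mul]
        _ ≤ (1016 / 1000 : ℝ) ^ 32 := pow_le_pow_left₀ (by positivity) hb1 _
        _ ≤ 2 := by norm_num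
    calc (1 + 1 / 1024 : ℝ) ^ k ≤ (1 + 1 / 1024 : ℝ) ^ (512 * (k / 512 + 1)) :=
          pow_le_pow_right₀ (by norm_num) (by omega)
      _ = ((1 + 1 / 1024 : ℝ) ^ 512) ^ (k / 512 + 1) := by rw [pow_mul]
      _ ≤ 2 ^ (k / 512 + 1) := pow_le_pow_left₀ (by positivity) hb _
  have e4 : ((1 / 1024 : ℝ)⁻¹) ^ m = 2 ^ (10 * m) := by
    rw [pow_mul]; norm_num
  have e5 : (64 / 63 : ℝ) ^ k ≤ 2 ^ (k / 32 + 1) := by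
    have hb : (64 / 63 : ℝ) ^ 32 ≤ 2 := by norm_num
    calc (64 / 63 : ℝ) ^ k ≤ (64 / 63 : ℝ) ^ (32 * (k / 32 + 1)) :=
          pow_le_pow_right₀ (by norm_num) (by omega)
      _ = ((64 / 63 : ℝ) ^ 32) ^ (k / 32 + 1) := by rw [pow_mul]
      _ ≤ 2 ^ (k / 32 + 1) := pow_le_pow_left₀ (by positivity) hb _
  have e6 : (64 : ℝ) ^ a = 2 ^ (6 * a) := by rw [pow_mul]; norm_num
  have hQb : Q ≤ 2 ^ (16 * h + k / 512 + 10 * m + 3) := by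
    rw [hQdef, e2, e4]
    calc (2 * (h:ℝ) ^ 2 * 2 ^ (14 * h)) * (2 * (1 + 1 / 1024 : ℝ) ^ k * 2 ^ (10 * m))
        ≤ (2 * 2 ^ (2 * h) * 2 ^ (14 * h)) * (2 * 2 ^ (k / 512 + 1) * 2 ^ (10 * m)) := by
          gcongr
      _ = 2 ^ (16 * h + k / 512 + 10 * m + 3) := by
          rw [show 16 * h + k / 512 + 10 * m + 3 =
            1 + 2 * h + 14 * h + (1 + (k / 512 + 1) + 10 * m) by ring]
          simp only [pow_add, pow_one]
  have hnb : n₀ ≤ 2 ^ (k / 32 + 6 * a + 2) := by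
    rw [hn₀, e6]
    calc (2:ℝ) * ((64 / 63) ^ k * 2 ^ (6 * a)) ≤ 2 * (2 ^ (k / 32 + 1) * 2 ^ (6 * a)) := by gcongr
      _ = 2 ^ (k / 32 + 6 * a + 2) := by ring
  have htot : Q ^ 30 * n₀ ≤ ((Finset.univ : Finset V).card : ℝ) := by
    calc Q ^ 30 * n₀ ≤ (2 ^ (16 * h + k / 512 + 10 * m + 3)) ^ 30 * 2 ^ (k / 32 + 6 * a + 2) := by
          gcongr
      _ = 2 ^ ((16 * h + k / 512 + 10 * m + 3) * 30 + (k / 32 + 6 * a + 2)) := by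
          rw [← pow_mul, ← pow_add]
      _ ≤ 2 ^ (k / 4) := pow_le_pow_right₀ (by norm_num)
          (fox_arith k h a m hk hhk ha hm)
      _ ≤ ((Finset.univ : Finset V).card : ℝ) := by
          rw [Finset.card_univ]; exact_mod_cast hV
  obtain ⟨C, _, I, _, h1, h2, h3⟩ := iter 30 Finset.univ htot
  have c1 : (C.card : ℝ) < k := by exact_mod_cast hC' C h1
  have c2 : (I.card : ℝ) < k := by exact_mod_cast hI' I h2
  have c3 : (C.card : ℝ) * I.card < k * k :=
    mul_lt_mul'' c1 c2 (by positivity) (by positivity)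
  have c4 : (k:ℝ) ≤ 384 * a := by exact_mod_cast hka
  have c5 : (k:ℝ) * k ≤ (384 * a) * (384 * a) := mul_le_mul c4 c4 (by positivity) (by positivity)
  have c6 : (384 * 384 : ℝ) ≤ (3 / 2) ^ 30 := by norm_num
  have c7 := mul_le_mul_of_nonneg_right c6 (show (0:ℝ) ≤ (a:ℝ) * a by positivity)
  linarith

open Classical in
/-- Averaging over vertex subsets of size `M`. -/
theorem fox_count {V : Type} [Fintype V] (k M : ℕ) (hkM : k ≤ M) (hM : M ≤ Fintype.card V)
    (F : Finset (Finset V)) (hF : ∀ s ∈ F, s.card = k)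
    (hT : ∀ T : Finset V, T.card = M → ∃ s ∈ F, s ⊆ T) :
    (Fintype.card V).choose k ≤ F.card * M ^ k := by
  have h1 : (Finset.univ : Finset V).powersetCard M ⊆
      F.biUnion (fun s => ((Finset.univ : Finset V).powersetCard M).filter (fun T => s ⊆ T)) := by
    intro T hTm
    obtain ⟨s, hs, hsT⟩ := hT T (Finset.mem_powersetCard.1 hTm).2
    exact Finset.mem_biUnion.2 ⟨s, hs, Finset.mem_filter.2 ⟨hTm, hsT⟩⟩
  have h2 : ∀ s ∈ F, (((Finset.univ : Finset V).powersetCard M).filter (fun T => s ⊆ T)).card ≤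
      (Fintype.card V - k).choose (M - k) := by
    intro s hs
    have hc : ((Finset.univ \ s).powersetCard (M - k)).card =
        (Fintype.card V - k).choose (M - k) := by
      rw [Finset.card_powersetCard, Finset.card_sdiff_of_subset (Finset.subset_univ _),
        Finset.card_univ, hF s hs]
    rw [← hc]
    refine Finset.card_le_card_of_injOn (fun T => T \ s) ?_ ?_
    · intro T hTm
      rw [Finset.mem_coe, Finset.mem_filter, Finset.mem_powersetCard] at hTm
      rw [Finset.mem_coe, Finset.mem_powersetCard]
      refine ⟨Finset.sdiff_subset_sdiff (Finset.subset_univ _) le_rfl, ?_⟩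
      rw [Finset.card_sdiff_of_subset hTm.2, hTm.1.2, hF s hs]
    · intro T hTm T' hTm' heq
      rw [Finset.mem_coe, Finset.mem_filter] at hTm hTm'
      have : T \ s ∪ s = T' \ s ∪ s := by simp only at heq; rw [heq]
      rwa [Finset.sdiff_union_of_subset hTm.2, Finset.sdiff_union_of_subset hTm'.2] at this
  have h3 : (Fintype.card V).choose M ≤ F.card * (Fintype.card V - k).choose (M - k) := by
    have := (Finset.card_le_card h1).trans (Finset.card_biUnion_le.trans
      (Finset.sum_le_card_nsmul _ _ _ h2))
    simpa [Finset.card_powersetCard] using this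
  have h4 := Nat.choose_mul (n := Fintype.card V) (k := M) (s := k) hkM
  have hpos : 0 < (Fintype.card V - k).choose (M - k) := Nat.choose_pos (by omega)
  have h5 : (Fintype.card V).choose k * (Fintype.card V - k).choose (M - k) ≤
      (F.card * M ^ k) * (Fintype.card V - k).choose (M - k) := by
    rw [← h4]
    calc (Fintype.card V).choose M * M.choose k
        ≤ (F.card * (Fintype.card V - k).choose (M - k)) * M ^ k :=
          Nat.mul_le_mul h3 (Nat.choose_le_pow _ _)
      _ = _ := by ring
  exact Nat.le_of_mul_le_mul_right h5 hpos

/-- Fox: there is a universal constant `c > 0` such that, for all large `k`, every large graph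
in which the densities of `k`-cliques and `k`-anticliques are both at most
`2^(-binom(k,2)) + ε` contains every graph on `⌊ck⌋` vertices as an induced subgraph. -/
theorem fox_few_cliques_universal :
    ∃ c : ℝ, 0 < c ∧ ∃ k₀ : ℕ, ∀ k : ℕ, k₀ ≤ k → ∃ ε : ℝ, 0 < ε ∧ ∃ N : ℕ,
      ∀ (V : Type) [Fintype V] (G : SimpleGraph V),
        N ≤ Fintype.card V →
        cliqueDensity k G ≤ (2 : ℝ) ^ (-(k.choose 2 : ℤ)) + ε →
        cliqueDensity k Gᶜ ≤ (2 : ℝ) ^ (-(k.choose 2 : ℤ)) + ε →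
        ∀ H : SimpleGraph (Fin ⌊c * (k : ℝ)⌋₊),
          ∃ f : Fin ⌊c * (k : ℝ)⌋₊ → V, Function.Injective f ∧
            ∀ i j, H.Adj i j ↔ G.Adj (f i) (f j) := by
  classical
  refine ⟨1 / 20000, by norm_num, 20000, fun k hk => ?_⟩
  refine ⟨(2 : ℝ) ^ (-(k.choose 2 : ℤ)), by positivity, 2 ^ (k / 4), ?_⟩
  intro V _ G hN hd1 hd2
  have hkr : (20000:ℝ) ≤ k := by exact_mod_cast hk
  have hh : 1 ≤ ⌊(1 / 20000 : ℝ) * (k : ℝ)⌋₊ := by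
    apply Nat.le_floor
    push_cast
    linarith
  have hhk : 20000 * ⌊(1 / 20000 : ℝ) * (k : ℝ)⌋₊ ≤ k := by
    have h1 := Nat.floor_le (show (0:ℝ) ≤ (1 / 20000 : ℝ) * (k : ℝ) by positivity)
    have h2 : (20000:ℝ) * (⌊(1 / 20000 : ℝ) * (k : ℝ)⌋₊ : ℝ) ≤ k := by linarith
    exact_mod_cast h2
  generalize ⌊(1 / 20000 : ℝ) * (k : ℝ)⌋₊ = h at hh hhk
  intro H
  by_contra hH
  set F₁ := ((Finset.univ : Finset V).powersetCard k).filter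
    (fun s : Finset V => G.IsClique (s : Set V)) with hF₁
  set F₂ := ((Finset.univ : Finset V).powersetCard k).filter
    (fun s : Finset V => Gᶜ.IsClique (s : Set V)) with hF₂
  have hkM : k ≤ 2 ^ (k / 4) := by
    have e1 : k / 8 < 2 ^ (k / 8) := Nat.lt_two_pow_self
    have e2 : (2:ℕ) ^ (k / 8) * 2 ^ (k / 8) ≤ 2 ^ (k / 4) := by
      rw [← pow_add]; exact Nat.pow_le_pow_right (by norm_num) (by omega)
    have e3 : k ≤ 8 * (k / 8 + 1) := by omega
    have e4 : 8 ≤ k / 8 := by omega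
    nlinarith
  have hcount := fox_count k (2 ^ (k / 4)) hkM hN (F₁ ∪ F₂)
    (by
      intro s hs
      rcases Finset.mem_union.1 hs with hs | hs
      · exact (Finset.mem_powersetCard.1 (Finset.mem_filter.1 hs).1).2
      · exact (Finset.mem_powersetCard.1 (Finset.mem_filter.1 hs).1).2)
    (by
      intro T hT
      by_contra hcon
      push Not at hcon
      have key : ∀ G' : SimpleGraph V, (∀ s : Finset V, s.card = k → G'.IsClique (s : Set V) →
          s ∈ F₁ ∪ F₂) → ∀ I : Finset T,
          (G'.comap (Subtype.val : T → V)).IsClique (I : Set T) → I.card ≠ k := by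
        intro G' hG' I hI hIk
        have hc : (I.map (Function.Embedding.subtype _)).card = k := by rw [Finset.card_map, hIk]
        refine hcon _ (hG' _ hc ?_) ?_
        · intro u hu v hv huv
          rw [Finset.mem_coe, Finset.mem_map] at hu hv
          obtain ⟨u', hu', rfl⟩ := hu
          obtain ⟨v', hv', rfl⟩ := hv
          exact hI hu' hv' (fun e => huv (by rw [e]))
        · intro u hu
          obtain ⟨u', hu', rfl⟩ := Finset.mem_map.1 hu
          exact u'.2
      have hcomp : (G.comap (Subtype.val : T → V))ᶜ = Gᶜ.comap (Subtype.val : T → V) := by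
        ext u v
        simp only [SimpleGraph.compl_adj, SimpleGraph.comap_adj, ne_eq]
        exact and_congr_left (fun _ => not_congr Subtype.ext_iff)
      obtain ⟨f, hf, hfa⟩ := fox_promel_rodl (G.comap (Subtype.val : T → V)) k h hk hh hhk
        (by rw [Fintype.card_coe, hT])
        (key G (fun s hs hcl => Finset.mem_union_left _ (Finset.mem_filter.2
          ⟨Finset.mem_powersetCard.2 ⟨Finset.subset_univ _, hs⟩, hcl⟩)))
        (by
          rw [hcomp]
          exact key Gᶜ (fun s hs hcl => Finset.mem_union_right _ (Finset.mem_filter.2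
            ⟨Finset.mem_powersetCard.2 ⟨Finset.subset_univ _, hs⟩, hcl⟩)))
        H
      exact hH ⟨fun i => (f i : V), Subtype.val_injective.comp hf, fun i j => hfa i j⟩)
  have hcu : (F₁ ∪ F₂).card ≤ F₁.card + F₂.card := Finset.card_union_le _ _
  have hchpos : 0 < (Fintype.card V).choose k := Nat.choose_pos (hkM.trans hN)
  have hchr : (0:ℝ) < ((Fintype.card V).choose k : ℝ) := by exact_mod_cast hchpos
  have hcr : ((Fintype.card V).choose k : ℝ) ≤
      ((F₁.card : ℝ) + F₂.card) * 2 ^ (k / 4 * k) := by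
    have := hcount.trans (Nat.mul_le_mul_right _ hcu)
    rw [← pow_mul] at this
    exact_mod_cast this
  have hD1 : cliqueDensity k G = (F₁.card : ℝ) / ((Fintype.card V).choose k : ℝ) := by
    rw [fox_density_eq]
  have hD2 : cliqueDensity k Gᶜ = (F₂.card : ℝ) / ((Fintype.card V).choose k : ℝ) := by
    rw [fox_density_eq, hF₂]
    congr!
  rw [hD1, div_le_iff₀ hchr] at hd1
  rw [hD2, div_le_iff₀ hchr] at hd2
  set z : ℝ := (2 : ℝ) ^ (-(k.choose 2 : ℤ)) with hz
  have hzpos : 0 < z := by positivity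
  have hze : z * 2 ^ (k.choose 2) = 1 := by
    rw [hz, zpow_neg, zpow_natCast]
    field_simp
  have hlt : 4 * (2:ℝ) ^ (k / 4 * k) < 2 ^ (k.choose 2) := by
    have : (4:ℝ) * 2 ^ (k / 4 * k) = 2 ^ (k / 4 * k + 2) := by ring
    rw [this]
    apply pow_lt_pow_right₀ (by norm_num)
    rw [Nat.choose_two_right, Nat.lt_iff_add_one_le, Nat.le_div_iff_mul_le (by norm_num)]
    obtain ⟨r, rfl⟩ : ∃ r, k = r + 1 := ⟨k - 1, by omega⟩
    simp only [Nat.add_sub_cancel]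
    have h4 : (r + 1) / 4 * 4 ≤ r + 1 := Nat.div_mul_le_self _ _
    have h5 : 100 ≤ r := by omega
    clear * - h4 h5
    nlinarith
  have h1 : ((Fintype.card V).choose k : ℝ) ≤
      (4 * z * ((Fintype.card V).choose k : ℝ)) * 2 ^ (k / 4 * k) := by
    refine hcr.trans (mul_le_mul_of_nonneg_right ?_ (by positivity))
    linarith
  have h2 : z * (4 * (2:ℝ) ^ (k / 4 * k)) < 1 := by
    rw [← hze]; exact mul_lt_mul_of_pos_left hlt hzpos
  nlinarith
end

section
/- For every a > 0 there exist b > 0 and N ∈ ℕ such that every tournament T on n ≥ N vertices with tr(T) < a·log n contains every tournament on ⌊b·log n⌋ vertices as a subtournament. -/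
open Finset

open Classical in
theorem pr_transOn_union {V : Type} {r : V → V → Prop} (hr : IsTournament r) {X Y : Finset V}
    (hX : TransOn r X) (hY : TransOn r Y) (h : ∀ x ∈ X, ∀ y ∈ Y, r x y) : TransOn r (X ∪ Y) := by
  have asym : ∀ x y, r x y → ¬ r y x := by
    intro x y h1 h2
    by_cases e : x = y
    · subst e; exact hr.1 x h1
    · exact (hr.2 x y e).1 h1 h2
  intro x hx y hy z hz h1 h2
  rw [Finset.mem_union] at hx hy hz
  rcases hx with hx | hx <;> rcases hy with hy | hy <;> rcases hz with hz | hz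
  · exact hX x hx y hy z hz h1 h2
  · exact h x hx z hz
  · exact absurd h2 (asym _ _ (h z hz y hy))
  · exact h x hx z hz
  · exact absurd h1 (asym _ _ (h y hy x hx))
  · exact absurd h1 (asym _ _ (h y hy x hx))
  · exact absurd h2 (asym _ _ (h z hz y hy))
  · exact hY x hx y hy z hz h1 h2

theorem pr_transOn_subset {V : Type} {r : V → V → Prop} {X Y : Finset V}
    (hX : TransOn r X) (h : Y ⊆ X) : TransOn r Y :=
  fun x hx y hy z hz => hX x (h hx) y (h hy) z (h hz)

open Classical in
theorem pr_exists_trans {V : Type} {r : V → V → Prop} (hr : IsTournament r) (s : ℕ) :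
    ∀ A : Finset V, 2 ^ s ≤ A.card → ∃ X ⊆ A, X.card = s ∧ TransOn r X := by
  induction s with
  | zero =>
    intro A _
    exact ⟨∅, by simp, by simp, fun x hx => by simp at hx⟩
  | succ s ih =>
    intro A hA
    have hne : A.Nonempty := by
      rw [← Finset.card_pos]
      exact lt_of_lt_of_le (by positivity) hA
    obtain ⟨v, hv⟩ := hne
    have hsing : TransOn r {v} := by
      intro x hx y hy z hz h1 h2
      simp only [Finset.mem_singleton] at hx hy hz
      subst hx; subst hy; exact absurd h1 (hr.1 _)
    have hcard := Finset.card_filter_add_card_filter_not (s := A.erase v) (fun y => r v y)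
    rw [Finset.card_erase_of_mem hv] at hcard
    have h2 : 2 ^ (s + 1) = 2 * 2 ^ s := by ring
    by_cases hc : 2 ^ s ≤ ((A.erase v).filter (fun y => r v y)).card
    · obtain ⟨X, hXA, hXc, hXt⟩ := ih _ hc
      have hv' : v ∉ X := fun h => by
        have := hXA h; simp at this
      refine ⟨{v} ∪ X, ?_, ?_, ?_⟩
      · intro x hx
        rcases Finset.mem_union.1 hx with h | h
        · rw [Finset.mem_singleton.1 h]; exact hv
        · have := hXA h
          simp at this; exact this.1.2
      · rw [Finset.card_union_of_disjoint (by simpa using hv'), hXc]; simp [add_comm]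
      · refine pr_transOn_union hr hsing hXt ?_
        intro x hx y hy
        rw [Finset.mem_singleton.1 hx]
        exact (Finset.mem_filter.1 (hXA hy)).2
    · have hc' : 2 ^ s ≤ ((A.erase v).filter (fun y => ¬ r v y)).card := by omega
      obtain ⟨X, hXA, hXc, hXt⟩ := ih _ hc'
      have hv' : v ∉ X := fun h => by
        have := hXA h; simp at this
      refine ⟨X ∪ {v}, ?_, ?_, ?_⟩
      · intro x hx
        rcases Finset.mem_union.1 hx with h | h
        · have := hXA h
          simp at this; exact this.1.2
        · rw [Finset.mem_singleton.1 h]; exact hv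
      · rw [Finset.card_union_of_disjoint (by simpa using hv'), hXc]; simp
      · refine pr_transOn_union hr hXt hsing ?_
        intro y hy x hx
        rw [Finset.mem_singleton.1 hx]
        have := hXA hy
        simp only [Finset.mem_filter, Finset.mem_erase] at this
        exact (hr.2 _ _ this.1.1).2 this.2

open Classical in
theorem pr_greedy {V : Type} (D : V → V → Prop) (X B : Finset V) (d δ : ℝ) (p : ℕ)
    (hδ : δ ≤ 1) (hd : d ≤ δ * p) (hδ0 : 0 ≤ δ) (hX : 2 * p ≤ X.card)
    (hB : ∀ b ∈ B, ((X.filter (fun x => ¬ D x b)).card : ℝ) ≤ d) (i : ℕ) :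
    i ≤ p → ∃ X' ⊆ X, ∃ B' ⊆ B, X'.card = i ∧ (∀ x ∈ X', ∀ b ∈ B', D x b) ∧
      (1 - δ) ^ i * (B.card : ℝ) ≤ B'.card := by
  induction i with
  | zero => intro _; exact ⟨∅, by simp, B, subset_rfl, by simp, by simp, by simp⟩
  | succ i ih =>
    intro hi
    obtain ⟨X', hX', B', hB', hc, hD, hcard⟩ := ih (by omega)
    have hYc : p ≤ (X \ X').card := by
      rw [Finset.card_sdiff_of_subset hX']; omega
    have hne : (X \ X').Nonempty := by
      rw [← Finset.card_pos]; omega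
    have hsum : ∑ x ∈ X \ X', ((B'.filter (fun b => ¬ D x b)).card : ℝ)
        ≤ ∑ x ∈ X \ X', δ * (B'.card : ℝ) := by
      have e := Finset.sum_card_bipartiteAbove_eq_sum_card_bipartiteBelow
        (s := X \ X') (t := B') (fun x b => ¬ D x b)
      unfold Finset.bipartiteAbove Finset.bipartiteBelow at e
      have e' : ∑ x ∈ X \ X', ((B'.filter (fun b => ¬ D x b)).card : ℝ) =
          ∑ b ∈ B', (((X \ X').filter (fun x => ¬ D x b)).card : ℝ) := by exact_mod_cast e
      rw [e']
      calc _ ≤ ∑ b ∈ B', d := by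
            refine Finset.sum_le_sum fun b hb => le_trans ?_ (hB b (hB' hb))
            exact_mod_cast Finset.card_le_card (Finset.filter_subset_filter _ Finset.sdiff_subset)
        _ = B'.card * d := by simp
        _ ≤ B'.card * (δ * p) := by gcongr
        _ ≤ B'.card * (δ * (X \ X').card) := by gcongr
        _ = _ := by simp; ring
    obtain ⟨x, hx, hxle⟩ := Finset.exists_le_of_sum_le hne hsum
    rw [Finset.mem_sdiff] at hx
    refine ⟨insert x X', ?_, B'.filter (fun b => D x b), ?_, ?_, ?_, ?_⟩
    · exact Finset.insert_subset hx.1 hX'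
    · exact (Finset.filter_subset _ _).trans hB'
    · rw [Finset.card_insert_of_notMem hx.2, hc]
    · intro y hy b hb
      rw [Finset.mem_filter] at hb
      rcases Finset.mem_insert.1 hy with h | h
      · rw [h]; exact hb.2
      · exact hD y h b hb.1
    · have h1 := Finset.card_filter_add_card_filter_not (s := B') (fun b => D x b)
      have h1' : ((B'.filter (fun b => D x b)).card : ℝ) +
        ((B'.filter (fun b => ¬ D x b)).card : ℝ) = B'.card := by exact_mod_cast h1
      have : (1 - δ) * ((1 - δ) ^ i * (B.card : ℝ)) ≤ (1 - δ) * B'.card :=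
        mul_le_mul_of_nonneg_left hcard (by linarith)
      rw [pow_succ]
      nlinarith

open Classical in
theorem pr_step {V : Type} (D : V → V → Prop) (X B : Finset V) (ε : ℝ) (p : ℕ) (hp : 0 < p)
    (hε0 : 0 < ε) (hε : 4 * ε ≤ 1) (hX : X.card = 2 * p)
    (h : ∀ a ∈ X, ((B.filter (fun b => ¬ D a b)).card : ℝ) ≤ ε * B.card) :
    ∃ X' ⊆ X, ∃ B' ⊆ B, X'.card = p ∧ (∀ x ∈ X', ∀ b ∈ B', D x b) ∧
      (1 - 4 * ε) ^ p * ((B.card : ℝ) / 2) ≤ B'.card := by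
  set G : V → Prop := fun b => ((X.filter (fun x => ¬ D x b)).card : ℝ) ≤ 4 * ε * p with hG
  obtain ⟨X', hX', B', hB', hc, hD, hcard⟩ := pr_greedy D X (B.filter G) (4 * ε * p) (4 * ε) p hε
    le_rfl (by positivity) hX.ge (fun b hb => (Finset.mem_filter.1 hb).2) p le_rfl
  refine ⟨X', hX', B', hB'.trans (Finset.filter_subset _ _), hc, hD, le_trans ?_ hcard⟩
  refine mul_le_mul_of_nonneg_left ?_ (pow_nonneg (by linarith) _)
  have e := Finset.sum_card_bipartiteAbove_eq_sum_card_bipartiteBelow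
        (s := X) (t := B) (fun x b => ¬ D x b)
  unfold Finset.bipartiteAbove Finset.bipartiteBelow at e
  have e' : ∑ x ∈ X, ((B.filter (fun b => ¬ D x b)).card : ℝ) =
          ∑ b ∈ B, ((X.filter (fun x => ¬ D x b)).card : ℝ) := by exact_mod_cast e
  have h1 : ∑ x ∈ X, ((B.filter (fun b => ¬ D x b)).card : ℝ) ≤ 2 * p * (ε * B.card) := by
    calc _ ≤ ∑ x ∈ X, ε * (B.card : ℝ) := Finset.sum_le_sum h
      _ = _ := by simp [hX]
  have h2 : ((B.filter (fun b => ¬ G b)).card : ℝ) * (4 * ε * p) ≤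
      ∑ b ∈ B, ((X.filter (fun x => ¬ D x b)).card : ℝ) := by
    calc _ = ∑ b ∈ B.filter (fun b => ¬ G b), 4 * ε * (p : ℝ) := by simp
      _ ≤ ∑ b ∈ B.filter (fun b => ¬ G b), ((X.filter (fun x => ¬ D x b)).card : ℝ) := by
          refine Finset.sum_le_sum fun b hb => ?_
          have := (Finset.mem_filter.1 hb).2
          exact (not_le.1 this).le
      _ ≤ _ := Finset.sum_le_sum_of_subset_of_nonneg (Finset.filter_subset _ _)
          (fun _ _ _ => by positivity)
  have h3 := Finset.card_filter_add_card_filter_not (s := B) G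
  have h3' : ((B.filter G).card : ℝ) + ((B.filter (fun b => ¬ G b)).card : ℝ) = B.card := by
    exact_mod_cast h3
  have hp' : (0 : ℝ) < p := by exact_mod_cast hp
  have h4 : ((B.filter (fun b => ¬ G b)).card : ℝ) ≤ B.card / 2 := by
    have hpos : 0 < 4 * ε * (p : ℝ) := by positivity
    refine le_of_mul_le_mul_right ?_ hpos
    nlinarith
  linarith

open Classical in
theorem pr_embed_s17 {V ι : Type} (r : V → V → Prop) (t : ι → ι → Prop)
    (hr : IsTournament r) (ht : IsTournament t) (U : Finset V) (ε M K : ℝ) (hε : 0 < ε)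
    (hε1 : ε ≤ 1) (hM : 0 < M)
    (h : ∀ D : V → V → Prop, (D = r ∨ D = fun x y => r y x) → ∀ A ⊆ U, ∀ B ⊆ U,
      M ≤ (A.card : ℝ) → M ≤ (B.card : ℝ) →
        ∃ a ∈ A, ε * B.card ≤ ((B.filter (fun b => D a b)).card : ℝ)) (v0 : V) (S : Finset ι) :
    ∀ W : ι → Finset V, (S.card : ℝ) ≤ K → 1 ≤ K → (∀ i ∈ S, W i ⊆ U) →
      (∀ i ∈ S, K * M ≤ ε ^ S.card * (W i).card) →
      ∃ f : ι → V, (∀ i ∈ S, f i ∈ W i) ∧ ∀ i ∈ S, ∀ j ∈ S, (t i j ↔ r (f i) (f j)) := by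
  induction S using Finset.induction_on with
  | empty => intro W _ _ _ _; exact ⟨fun _ => v0, by simp, by simp⟩
  | insert i0 S hi0 ih =>
    intro W hK hK1 hWU hW
    rw [Finset.card_insert_of_notMem hi0] at hK hW
    push_cast at hK
    have hbig : ∀ i ∈ insert i0 S, K * M ≤ (W i).card := by
      intro i hi
      refine (hW i hi).trans ?_
      exact mul_le_of_le_one_left (by positivity) (pow_le_one₀ hε.le hε1)
    set R : ι → V → V → Prop := fun j => if t i0 j then r else fun x y => r y x with hR
    have hRr : ∀ j, R j = r ∨ R j = fun x y => r y x := by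
      intro j
      by_cases hj : t i0 j
      · left; simp [hR, hj]
      · right; simp [hR, hj]
    set bad : ι → Finset V := fun j => (W i0).filter
      (fun a => (((W j).filter (fun b => R j a b)).card : ℝ) < ε * (W j).card) with hbad
    have hMK : M ≤ K * M := le_mul_of_one_le_left hM.le hK1
    have hbadc : ∀ j ∈ S, ((bad j).card : ℝ) ≤ M := by
      intro j hj
      by_contra hcon
      push Not at hcon
      obtain ⟨a, ha, ha2⟩ := h (R j) (hRr j) (bad j)
        ((Finset.filter_subset _ _).trans (hWU i0 (by simp))) (W j) (hWU j (by simp [hj]))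
        hcon.le (hMK.trans (hbig j (by simp [hj])))
      exact absurd (Finset.mem_filter.1 ha).2 (not_lt.2 ha2)
    have hun : ((S.biUnion bad).card : ℝ) < (W i0).card := by
      calc ((S.biUnion bad).card : ℝ) ≤ ∑ j ∈ S, ((bad j).card : ℝ) := by
            exact_mod_cast Finset.card_biUnion_le
        _ ≤ ∑ j ∈ S, M := Finset.sum_le_sum hbadc
        _ = S.card * M := by simp
        _ < K * M := by
            refine mul_lt_mul_of_pos_right ?_ hM
            linarith
        _ ≤ _ := hbig i0 (by simp)
    obtain ⟨a, haW, hab⟩ := Finset.exists_mem_notMem_of_card_lt_card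
      (by exact_mod_cast hun : (S.biUnion bad).card < (W i0).card)
    have hgood : ∀ j ∈ S, ε * (W j).card ≤ (((W j).filter (fun b => R j a b)).card : ℝ) := by
      intro j hj
      by_contra hcon
      push Not at hcon
      exact hab (Finset.mem_biUnion.2 ⟨j, hj, Finset.mem_filter.2 ⟨haW, hcon⟩⟩)
    obtain ⟨f, hf1, hf2⟩ := ih (fun j => (W j).filter (fun b => R j a b)) (by linarith) hK1
      (fun i hi => (Finset.filter_subset _ _).trans (hWU i (by simp [hi])))
      (by
        intro i hi
        refine (hW i (by simp [hi])).trans ?_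
        rw [pow_succ, mul_assoc]
        exact mul_le_mul_of_nonneg_left (hgood i hi) (by positivity))
    have hne : ∀ i ∈ S, i ≠ i0 := fun i hi e => hi0 (e ▸ hi)
    have key : ∀ j ∈ S, (t i0 j ↔ r a (f j)) ∧ (t j i0 ↔ r (f j) a) := by
      intro j hj
      have hRj : R j a (f j) := (Finset.mem_filter.1 (hf1 j hj)).2
      by_cases hj' : t i0 j
      · have h1 : r a (f j) := by simpa [hR, hj'] using hRj
        have hn : a ≠ f j := fun e => hr.1 a (by rw [← e] at h1; exact h1)
        have h2 := (hr.2 _ _ hn).1 h1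
        have h3 := (ht.2 _ _ (hne j hj).symm).1 hj'
        tauto
      · have h1 : r (f j) a := by simpa [hR, hj'] using hRj
        have hn : f j ≠ a := fun e => hr.1 a (by rw [e] at h1; exact h1)
        have h2 := (hr.2 _ _ hn).1 h1
        have h3 := (ht.2 _ _ (hne j hj)).2 hj'
        tauto
    refine ⟨Function.update f i0 a, ?_, ?_⟩
    · intro i hi
      rcases Finset.mem_insert.1 hi with e | hi
      · subst e; simpa using haW
      · rw [Function.update_of_ne (hne i hi)]
        exact (Finset.mem_filter.1 (hf1 i hi)).1
    · intro i hi j hj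
      rcases Finset.mem_insert.1 hi with e | hi2 <;> rcases Finset.mem_insert.1 hj with e' | hj2
      · subst e; subst e'; simp [hr.1, ht.1]
      · subst e
        rw [Function.update_of_ne (hne j hj2), Function.update_self]
        exact (key j hj2).1
      · subst e'
        rw [Function.update_of_ne (hne i hi2), Function.update_self]
        exact (key i hi2).2
      · rw [Function.update_of_ne (hne i hi2), Function.update_of_ne (hne j hj2)]
        exact hf2 i hi2 j hj2

/-- One stage: a set `U` of a tournament not containing `t` yields a transitive set `X'` of size
`p` homogeneous to a fairly large subset `B'`. -/
theorem pr_stage {V : Type} (r : V → V → Prop) (hr : IsTournament r) (k : ℕ)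
    (t : Fin k → Fin k → Prop) (ht : IsTournament t)
    (hno : ¬ ∃ f : Fin k → V, ∀ i j, t i j ↔ r (f i) (f j)) (U : Finset V) (ε : ℝ)
    (hε : 0 < ε) (hε1 : 8 * ε ≤ 1) (p : ℕ) (hp : 0 < p)
    (hM1 : 1 ≤ ε * (U.card * ε ^ k / (k + 1))) (hM2 : (4 : ℝ) ^ p ≤ U.card * ε ^ k / (k + 1)) :
    ∃ X ⊆ U, ∃ B ⊆ U, X.card = p ∧ TransOn r X ∧
      ((∀ x ∈ X, ∀ b ∈ B, r x b) ∨ (∀ x ∈ X, ∀ b ∈ B, r b x)) ∧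
      (1 - 8 * ε) ^ p * (ε ^ k / (2 * (k + 1))) * U.card ≤ B.card := by
  classical
  set M : ℝ := U.card * ε ^ k / (k + 1) with hMdef
  have hM : 0 < M := lt_of_lt_of_le (by positivity) hM2
  have hUne : U.Nonempty := by
    rw [Finset.nonempty_iff_ne_empty]
    rintro rfl
    simp at hMdef
    exact hM.ne' hMdef
  obtain ⟨v0, hv0⟩ := hUne
  have hmain : ∃ D : V → V → Prop, (D = r ∨ D = fun x y => r y x) ∧ ∃ A ⊆ U, ∃ B ⊆ U,
      M ≤ (A.card : ℝ) ∧ M ≤ (B.card : ℝ) ∧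
        ∀ a ∈ A, ((B.filter (fun b => D a b)).card : ℝ) < ε * B.card := by
    by_contra hcon
    push Not at hcon
    obtain ⟨f, _, hf⟩ := pr_embed_s17 r t hr ht U ε M (k + 1) hε (by linarith) hM hcon v0
      Finset.univ (fun _ => U) (by simp) (by simp) (fun _ _ => subset_rfl) (by
        intro i _
        rw [hMdef]
        simp only [Finset.card_univ, Fintype.card_fin]
        apply le_of_eq
        field_simp)
    exact hno ⟨f, fun i j => hf i (by simp) j (by simp)⟩
  obtain ⟨D, hD, A, hAU, B, hBU, hA, hB, hAB⟩ := hmain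
  have hA2 : 2 ^ (2 * p) ≤ A.card := by
    have : (4 : ℝ) ^ p ≤ A.card := hM2.trans hA
    rw [pow_mul]
    norm_num
    exact_mod_cast this
  obtain ⟨X, hXA, hXc, hXt⟩ := pr_exists_trans hr (2 * p) A hA2
  have h1 : 1 ≤ ε * (B.card : ℝ) := hM1.trans (mul_le_mul_of_nonneg_left hB hε.le)
  have hX2 : ∀ a ∈ X, ((B.filter (fun b => ¬ D b a)).card : ℝ) ≤ 2 * ε * B.card := by
    intro a ha
    have hsub : B.filter (fun b => ¬ D b a) ⊆ insert a (B.filter (fun b => D a b)) := by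
      intro b hb
      rw [Finset.mem_filter] at hb
      by_cases e : b = a
      · simp [e]
      · rw [Finset.mem_insert, Finset.mem_filter]
        right
        refine ⟨hb.1, ?_⟩
        rcases hD with rfl | rfl
        · exact (hr.2 _ _ (Ne.symm e)).2 hb.2
        · exact (hr.2 _ _ e).2 hb.2
    have h2 := (Finset.card_le_card hsub).trans (Finset.card_insert_le _ _)
    have h2' : ((B.filter (fun b => ¬ D b a)).card : ℝ) ≤
      ((B.filter (fun b => D a b)).card : ℝ) + 1 := by exact_mod_cast h2
    have := hAB a (hXA ha)
    linarith
  obtain ⟨X', hX', B', hB', hc, hDD, hcard⟩ := pr_step (fun a b => D b a) X B (2 * ε) p hp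
    (by linarith) (by linarith) hXc hX2
  refine ⟨X', (hX'.trans hXA).trans hAU, B', hB'.trans hBU, hc, pr_transOn_subset hXt hX', ?_, ?_⟩
  · rcases hD with rfl | rfl
    · right; exact hDD
    · left; exact hDD
  · refine le_trans ?_ hcard
    have e : 4 * (2 * ε) = 8 * ε := by ring
    rw [e, mul_assoc]
    refine mul_le_mul_of_nonneg_left ?_ (pow_nonneg (by linarith) _)
    calc ε ^ k / (2 * (k + 1)) * (U.card : ℝ) = M / 2 := by rw [hMdef]; field_simp
      _ ≤ _ := by linarith

theorem pr_iterate {V : Type} (r : V → V → Prop) (hr : IsTournament r) (m c : ℝ) (p : ℕ)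
    (hc0 : 0 < c) (hc1 : c ≤ 1)
    (h : ∀ U : Finset V, m ≤ (U.card : ℝ) → ∃ X ⊆ U, ∃ B ⊆ U, X.card = p ∧ TransOn r X ∧
      ((∀ x ∈ X, ∀ b ∈ B, r x b) ∨ (∀ x ∈ X, ∀ b ∈ B, r b x)) ∧ c * U.card ≤ (B.card : ℝ))
    (J : ℕ) : ∀ U : Finset V, m ≤ c ^ J * (U.card : ℝ) →
      ∃ Y ⊆ U, Y.card = J * p ∧ TransOn r Y := by
  classical
  induction J with
  | zero => intro U _; exact ⟨∅, by simp, by simp, fun x hx => by simp at hx⟩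
  | succ J ih =>
    intro U hU
    obtain ⟨X, hX, B, hB, hXc, hXt, hXB, hcard⟩ := h U (hU.trans
      (mul_le_of_le_one_left (by positivity) (pow_le_one₀ hc0.le hc1)))
    obtain ⟨Y, hY, hYc, hYt⟩ := ih B (by
      refine hU.trans ?_
      rw [pow_succ, mul_assoc]
      exact mul_le_mul_of_nonneg_left hcard (by positivity))
    have hdisj : Disjoint X Y := by
      rw [Finset.disjoint_left]
      intro x hx hy
      rcases hXB with h | h
      · exact hr.1 x (h x hx x (hY hy))
      · exact hr.1 x (h x hx x (hY hy))
    refine ⟨X ∪ Y, Finset.union_subset hX (hY.trans hB), ?_, ?_⟩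
    · rw [Finset.card_union_of_disjoint hdisj, hXc, hYc]; ring
    · rcases hXB with h | h
      · exact pr_transOn_union hr hXt hYt (fun x hx y hy => h x hx y (hY hy))
      · rw [Finset.union_comm]
        exact pr_transOn_union hr hYt hXt (fun y hy x hx => h x hx y (hY hy))

set_option maxHeartbeats 2000000 in
/-- Prömel–Rödl for tournaments: for every `a > 0` there is `b > 0` such that every large
tournament on `n` vertices with no transitive subtournament of size `a·log n` contains
every tournament on `⌊b·log n⌋` vertices as a subtournament. -/
theorem promel_rodl_tournaments :
    ∀ a : ℝ, 0 < a → ∃ b : ℝ, 0 < b ∧ ∃ N : ℕ,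
      ∀ (V : Type) [Fintype V] (r : V → V → Prop),
        IsTournament r → N ≤ Fintype.card V →
        (∀ s : Finset V, TransOn r s → (s.card : ℝ) < a * Real.log (Fintype.card V)) →
        ∀ t : Fin ⌊b * Real.log (Fintype.card V)⌋₊ →
              Fin ⌊b * Real.log (Fintype.card V)⌋₊ → Prop,
          IsTournament t →
          ∃ f : Fin ⌊b * Real.log (Fintype.card V)⌋₊ → V, Function.Injective f ∧
            ∀ i j, t i j ↔ r (f i) (f j) := by
  intro a ha
  set J : ℕ := ⌈16 * a⌉₊ with hJ
  have hJ0 : 0 < J := Nat.ceil_pos.2 (by linarith)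
  have hJa : 16 * a ≤ J := Nat.le_ceil _
  have hJ1 : (1 : ℝ) ≤ J := by exact_mod_cast hJ0
  obtain ⟨η, hη⟩ : ∃ η : ℝ, η = 1 / (2 * J) := ⟨_, rfl⟩
  have hη0 : 0 < η := by rw [hη]; positivity
  have hηJ : η * J = 1 / 2 := by rw [hη]; field_simp
  have hη1 : η ≤ 1 / 2 := by nlinarith
  obtain ⟨ε, hε⟩ : ∃ ε : ℝ, ε = η / 8 := ⟨_, rfl⟩
  have hε0 : 0 < ε := by rw [hε]; positivity
  have hε1 : 8 * ε ≤ 1 / 2 := by linarith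
  have hl : 0 < -Real.log ε := by
    have := Real.log_neg hε0 (by linarith); linarith
  obtain ⟨b, hb⟩ : ∃ b : ℝ, b = η / (4 * (-Real.log ε)) := ⟨_, rfl⟩
  have hb0 : 0 < b := by rw [hb]; positivity
  have hbl : b * (-Real.log ε) = η / 4 := by rw [hb]; have hl' := hl.ne'; generalize -Real.log ε = q at hl'; field_simp
  have hev : ∀ᶠ L : ℝ in Filter.atTop, 2 * (b * L + 1) ≤ Real.exp (η * L / 4) := by
    have h1 : (fun L : ℝ => 2 * (b * L + 1)) =o[Filter.atTop] fun L => Real.exp (η / 4 * L) := by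
      have e1 : (fun L : ℝ => L) =o[Filter.atTop] fun L => Real.exp (η / 4 * L) := by
        simpa using isLittleO_pow_exp_pos_mul_atTop (k := 1) (b := η / 4) (by positivity)
      have e0 : (fun L : ℝ => (1 : ℝ)) =o[Filter.atTop] fun L => Real.exp (η / 4 * L) := by
        simpa using isLittleO_pow_exp_pos_mul_atTop (k := 0) (b := η / 4) (by positivity)
      exact ((e1.const_mul_left b).add e0).const_mul_left 2
    filter_upwards [h1.bound (c := 1) one_pos] with L hL
    rw [one_mul, Real.norm_eq_abs, Real.norm_eq_abs, Real.abs_exp] at hL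
    refine (le_abs_self _).trans (hL.trans (le_of_eq ?_))
    congr 1; ring
  have hev2 : ∀ᶠ n : ℕ in Filter.atTop,
      (2 * (b * Real.log n + 1) ≤ Real.exp (η * Real.log n / 4)) ∧ 16 ≤ Real.log n ∧
        4 * (-Real.log ε) ≤ Real.log n :=
    (Real.tendsto_log_atTop.comp tendsto_natCast_atTop_atTop).eventually
      (hev.and ((Filter.eventually_ge_atTop 16).and (Filter.eventually_ge_atTop _)))
  obtain ⟨N, hN⟩ := Filter.eventually_atTop.1 hev2
  refine ⟨b, hb0, N, ?_⟩
  intro V _ r hr hcard htr t ht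
  obtain ⟨hL1, hL2, hL3⟩ := hN _ hcard
  have hninj : ¬ ¬ ∃ f : Fin ⌊b * Real.log (Fintype.card V)⌋₊ → V,
      ∀ i j, t i j ↔ r (f i) (f j) := by
    intro hno
    generalize hk : ⌊b * Real.log (Fintype.card V)⌋₊ = k at t ht hno
    obtain ⟨L, hL⟩ : ∃ L, L = Real.log (Fintype.card V) := ⟨_, rfl⟩
    rw [← hL] at hL1 hL2 hL3 hk htr
    have hkL : (k : ℝ) ≤ b * L := by
      rw [← hk]; exact Nat.floor_le (by positivity)
    have hn : Real.exp L = Fintype.card V := by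
      rw [hL, Real.exp_log]
      by_contra hcon
      have h0 : (Fintype.card V : ℝ) = 0 := le_antisymm (not_lt.1 hcon) (by positivity)
      rw [h0, Real.log_zero] at hL
      linarith
    obtain ⟨p, hp⟩ : ∃ p, p = ⌊L / 8⌋₊ := ⟨_, rfl⟩
    have hp1 : (p : ℝ) ≤ L / 8 := by rw [hp]; exact Nat.floor_le (by linarith)
    have hp2 : L / 16 ≤ p := by
      have := Nat.lt_floor_add_one (L / 8)
      rw [← hp] at this
      linarith
    have hp0 : 0 < p := by
      have : (0 : ℝ) < p := by linarith
      exact_mod_cast this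
    have hεk : Real.exp (-(η * L / 4)) ≤ ε ^ k := by
      rw [← Real.exp_log hε0, ← Real.exp_nat_mul, Real.exp_le_exp]
      nlinarith
    have hkk : (2 * ((k : ℝ) + 1)) ≤ Real.exp (η * L / 4) := by linarith
    have hδ : Real.exp (-(η * L / 4)) ≤ (1 - 8 * ε) ^ p := by
      have h1 : Real.exp (-(16 * ε)) ≤ 1 - 8 * ε := by
        rw [Real.exp_neg]
        have h2 := Real.add_one_le_exp (16 * ε)
        calc (Real.exp (16 * ε))⁻¹ ≤ (16 * ε + 1)⁻¹ := inv_anti₀ (by positivity) h2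
          _ ≤ _ := by
            rw [inv_le_iff_one_le_mul₀ (by positivity)]
            nlinarith
      calc _ ≤ Real.exp (-(16 * ε)) ^ p := by
            rw [← Real.exp_nat_mul, Real.exp_le_exp]
            nlinarith
        _ ≤ _ := pow_le_pow_left₀ (Real.exp_pos _).le h1 p
    have hεk2 : Real.exp (-(η * L / 2)) ≤ ε ^ k / (2 * (k + 1)) := by
      rw [le_div_iff₀ (by positivity)]
      calc _ ≤ Real.exp (-(η * L / 2)) * Real.exp (η * L / 4) := by gcongr
        _ = Real.exp (-(η * L / 4)) := by rw [← Real.exp_add]; congr 1; ring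
        _ ≤ _ := hεk
    obtain ⟨c, hc⟩ : ∃ c : ℝ, c = (1 - 8 * ε) ^ p * (ε ^ k / (2 * (k + 1))) := ⟨_, rfl⟩
    have hcL : Real.exp (-(η * L)) ≤ c := by
      calc _ ≤ Real.exp (-(η * L / 4)) * Real.exp (-(η * L / 2)) := by
            rw [← Real.exp_add, Real.exp_le_exp]; nlinarith
        _ ≤ _ := by rw [hc]; exact mul_le_mul hδ hεk2 (Real.exp_pos _).le (pow_nonneg (by linarith) _)
    have hc1 : c ≤ 1 := by
      rw [hc]
      refine mul_le_one₀ (pow_le_one₀ (by linarith) (by linarith)) (by positivity) ?_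
      rw [div_le_one (by positivity)]
      have := pow_le_one₀ (n := k) hε0.le (by linarith)
      have : (0 : ℝ) ≤ k := by positivity
      linarith
    have hstage : ∀ U : Finset V, Real.exp (L / 2) ≤ (U.card : ℝ) →
        Real.exp (L / 4) ≤ U.card * ε ^ k / (k + 1) := by
      intro U hU
      calc Real.exp (L / 4) ≤ Real.exp (L / 2) * Real.exp (-(η * L / 2)) := by
            rw [← Real.exp_add, Real.exp_le_exp]; nlinarith
        _ ≤ U.card * (ε ^ k / (2 * (k + 1))) := by gcongr
        _ ≤ U.card * (ε ^ k / (k + 1)) := by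
            gcongr
            have : (0 : ℝ) ≤ k := by positivity
            linarith
        _ = _ := by ring
    obtain ⟨Y, _, hYc, hYt⟩ := pr_iterate r hr (Real.exp (L / 2)) c p
      (lt_of_lt_of_le (Real.exp_pos _) hcL) hc1 (by
        intro U hU
        have h1 := hstage U hU
        rw [hc]
        refine pr_stage r hr k t ht hno U ε hε0 (by linarith) p hp0 ?_ ?_
        · calc (1 : ℝ) = Real.exp 0 := by simp
            _ ≤ Real.exp (Real.log ε + L / 4) := by rw [Real.exp_le_exp]; linarith
            _ = ε * Real.exp (L / 4) := by rw [Real.exp_add, Real.exp_log hε0]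
            _ ≤ _ := by gcongr
        · refine le_trans ?_ h1
          have h4 : (4 : ℝ) ≤ Real.exp 2 := by
            have := Real.add_one_le_exp (1 : ℝ)
            have e : Real.exp 2 = Real.exp 1 * Real.exp 1 := by rw [← Real.exp_add]; norm_num
            nlinarith
          calc (4 : ℝ) ^ p ≤ Real.exp 2 ^ p := by gcongr
            _ = Real.exp (p * 2) := by rw [← Real.exp_nat_mul]
            _ ≤ _ := by rw [Real.exp_le_exp]; linarith) J Finset.univ (by
        rw [Finset.card_univ, ← hn]
        calc Real.exp (L / 2) = Real.exp (-(η * L)) ^ J * Real.exp L := by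
              rw [← Real.exp_nat_mul, ← Real.exp_add]
              congr 1
              linear_combination L * hηJ
          _ ≤ _ := by gcongr)
    have := htr Y hYt
    rw [hYc] at this
    push_cast at this
    nlinarith
  obtain ⟨f, hf⟩ := not_not.1 hninj
  refine ⟨f, ?_, hf⟩
  intro i j hij
  by_contra hne
  by_cases h : t i j
  · have := (hf i j).1 h
    rw [hij] at this
    exact hr.1 _ this
  · have h' : t j i := (ht.2 _ _ (Ne.symm hne)).2 h
    have := (hf j i).1 h'
    rw [hij] at this
    exact hr.1 _ this
end
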